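/- arXiv:2310.07420 — 3 statements merged into one kernel-verified Lean document; each statement's English description precedes it below -/
import Mathlib

section
/- Under the time-dependent stability setup with hypotheses (H1), (H2), (H3'), suppose for each n ∈ ℕ the function u^n : (0,∞) × X_n → ℝ is a metric viscosity supersolution of ∂_t u^n + H_n(t, x, u^n, |∇_{d_n} u^n|) = 0 on (0,∞) × X_n, and the family (u^n) is uniformly bounded. Then the lower semilimit u̲(t,x) := inf{ liminf_{n→∞} u^n(t_n, x_n) : t_n → t, x_n ∈ X_n, 𝖽(x_n, x) → 0 }, defined for t > 0 and x ∈ X_∞, is a metric viscosity supersolution of ∂_t u̲ + H_∞(t, x, u̲, |∇_{d_∞} u̲|) = 0 on (0,∞) × X_∞. -/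
open Filter Metric Set Topology

/-- Local slope of `u` at `x`, relative to a set `s` and a distance-like function `ρ`. -/
noncomputable def slopeWrt {α : Type*} [TopologicalSpace α] (s : Set α) (ρ : α → α → ℝ)
    (u : α → ℝ) (x : α) : ℝ :=
  Filter.limsup (fun y => |u y - u x| / ρ x y) (nhdsWithin x (s \ {x}))

/-- Upper local slope. -/
noncomputable def upperSlopeWrt {α : Type*} [TopologicalSpace α] (s : Set α) (ρ : α → α → ℝ)
    (u : α → ℝ) (x : α) : ℝ :=
  Filter.limsup (fun y => max (u y - u x) 0 / ρ x y) (nhdsWithin x (s \ {x}))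

/-- Lower local slope. -/
noncomputable def lowerSlopeWrt {α : Type*} [TopologicalSpace α] (s : Set α) (ρ : α → α → ℝ)
    (u : α → ℝ) (x : α) : ℝ :=
  Filter.limsup (fun y => max (u x - u y) 0 / ρ x y) (nhdsWithin x (s \ {x}))

/-- `u` is locally Lipschitz on `s` with respect to `ρ`. -/
def LocLipWrt {α : Type*} [TopologicalSpace α] (s : Set α) (ρ : α → α → ℝ)
    (u : α → ℝ) : Prop :=
  ∀ x ∈ s, ∃ K : ℝ, ∃ t ∈ nhdsWithin x s, ∀ y ∈ t ∩ s, ∀ z ∈ t ∩ s, |u y - u z| ≤ K * ρ y z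

/-- `u` is of class `C^{1,-}`: locally Lipschitz, with continuous local slope which
coincides with the lower local slope. -/
def IsC1MinusWrt {α : Type*} [TopologicalSpace α] (s : Set α) (ρ : α → α → ℝ)
    (u : α → ℝ) : Prop :=
  LocLipWrt s ρ u ∧ ContinuousOn (slopeWrt s ρ u) s ∧
    ∀ x ∈ s, lowerSlopeWrt s ρ u x = slopeWrt s ρ u x

/-- `u` is of class `C^{1,+}`: locally Lipschitz, with continuous local slope which
coincides with the upper local slope. -/
def IsC1PlusWrt {α : Type*} [TopologicalSpace α] (s : Set α) (ρ : α → α → ℝ)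
    (u : α → ℝ) : Prop :=
  LocLipWrt s ρ u ∧ ContinuousOn (slopeWrt s ρ u) s ∧
    ∀ x ∈ s, upperSlopeWrt s ρ u x = slopeWrt s ρ u x

/-- Upper semicontinuous envelope of `u` relative to `s`. -/
noncomputable def uscWrt {α : Type*} [TopologicalSpace α] (s : Set α) (u : α → ℝ) (x : α) : ℝ :=
  Filter.limsup u (nhdsWithin x s)

/-- Lower semicontinuous envelope of `u` relative to `s`. -/
noncomputable def lscWrt {α : Type*} [TopologicalSpace α] (s : Set α) (u : α → ℝ) (x : α) : ℝ :=
  Filter.liminf u (nhdsWithin x s)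

/-- `H_a(x,r,p) = inf { H x r q | q ≥ 0, |q - p| ≤ a }`. -/
noncomputable def Hlow {α : Type*} (H : α → ℝ → ℝ → ℝ) (a : ℝ) (x : α) (r p : ℝ) : ℝ :=
  sInf (H x r '' {q | 0 ≤ q ∧ |q - p| ≤ a})

/-- `H^a(x,r,p) = sup { H x r q | q ≥ 0, |q - p| ≤ a }`. -/
noncomputable def Hupp {α : Type*} (H : α → ℝ → ℝ → ℝ) (a : ℝ) (x : α) (r p : ℝ) : ℝ :=
  sSup (H x r '' {q | 0 ≤ q ∧ |q - p| ≤ a})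

/-- Metric viscosity subsolution of `H(x, u, |∇u|) = 0` on the space `(s, ρ)`. -/
def IsMVSubsolutionWrt {α : Type*} [TopologicalSpace α] (s : Set α) (ρ : α → α → ℝ)
    (H : α → ℝ → ℝ → ℝ) (u : α → ℝ) : Prop :=
  ∀ ψ₁ ψ₂ : α → ℝ, IsC1MinusWrt s ρ ψ₁ → LocLipWrt s ρ ψ₂ →
    ∀ x ∈ s, IsLocalMaxOn (fun y => uscWrt s u y - (ψ₁ y + ψ₂ y)) s x →
      Hlow H (uscWrt s (slopeWrt s ρ ψ₂) x) x (uscWrt s u x) (slopeWrt s ρ ψ₁ x) ≤ 0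

/-- Metric viscosity supersolution of `H(x, u, |∇u|) = 0` on the space `(s, ρ)`. -/
def IsMVSupersolutionWrt {α : Type*} [TopologicalSpace α] (s : Set α) (ρ : α → α → ℝ)
    (H : α → ℝ → ℝ → ℝ) (u : α → ℝ) : Prop :=
  ∀ ψ₁ ψ₂ : α → ℝ, IsC1PlusWrt s ρ ψ₁ → LocLipWrt s ρ ψ₂ →
    ∀ x ∈ s, IsLocalMinOn (fun y => lscWrt s u y - (ψ₁ y + ψ₂ y)) s x →
      0 ≤ Hupp H (uscWrt s (slopeWrt s ρ ψ₂) x) x (lscWrt s u x) (slopeWrt s ρ ψ₁ x)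

/-- `(s, ρ)` is a geodesic space: any two points are joined by an isometric
embedding of the interval `[0, ρ x y]`. -/
def IsGeodesicWrt {α : Type*} (s : Set α) (ρ : α → α → ℝ) : Prop :=
  ∀ x ∈ s, ∀ y ∈ s, ∃ γ : ℝ → α, γ 0 = x ∧ γ (ρ x y) = y ∧
    (∀ t ∈ Icc (0:ℝ) (ρ x y), γ t ∈ s) ∧
    ∀ t₁ ∈ Icc (0:ℝ) (ρ x y), ∀ t₂ ∈ Icc (0:ℝ) (ρ x y), ρ (γ t₁) (γ t₂) = |t₁ - t₂|

/-- Strict local maximum of `f` on `s` at `x`. -/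
def IsStrictLocalMaxOn' {α : Type*} [TopologicalSpace α] (f : α → ℝ) (s : Set α) (x : α) : Prop :=
  ∀ᶠ y in nhdsWithin x (s \ {x}), f y < f x

/-- Strict local minimum of `f` on `s` at `x`. -/
def IsStrictLocalMinOn' {α : Type*} [TopologicalSpace α] (f : α → ℝ) (s : Set α) (x : α) : Prop :=
  ∀ᶠ y in nhdsWithin x (s \ {x}), f x < f y

/-- `u` is locally bounded on `s`. -/
def LocBddWrt {α : Type*} [TopologicalSpace α] (s : Set α) (u : α → ℝ) : Prop :=
  ∀ x ∈ s, ∃ C : ℝ, ∀ᶠ y in nhdsWithin x s, |u y| ≤ C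

/-- `ρ` is a metric on the subset `S` of the ambient metric space `Y`, bounded below by the
ambient distance and inducing the subspace topology on `S`. -/
structure IsMetricOn {Y : Type*} [MetricSpace Y] (S : Set Y) (ρ : Y → Y → ℝ) : Prop where
  refl : ∀ x ∈ S, ρ x x = 0
  symm : ∀ x ∈ S, ∀ y ∈ S, ρ x y = ρ y x
  triangle : ∀ x ∈ S, ∀ y ∈ S, ∀ z ∈ S, ρ x z ≤ ρ x y + ρ y z
  ge_dist : ∀ x ∈ S, ∀ y ∈ S, dist x y ≤ ρ x y
  nhds_basis : ∀ x ∈ S, (nhdsWithin x S).HasBasis (fun ε : ℝ => 0 < ε)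
    (fun ε => {y | y ∈ S ∧ ρ x y < ε})

/-- Spatial local slope of `ψ : (0,∞) × X → ℝ` at `z = (t, x)`. -/
noncomputable def slopeSpWrt {α : Type*} [TopologicalSpace α] (s : Set α) (ρ : α → α → ℝ)
    (ψ : ℝ × α → ℝ) (z : ℝ × α) : ℝ :=
  Filter.limsup (fun y => |ψ (z.1, y) - ψ z| / ρ z.2 y) (nhdsWithin z.2 (s \ {z.2}))

/-- Spatial upper local slope. -/
noncomputable def upperSlopeSpWrt {α : Type*} [TopologicalSpace α] (s : Set α) (ρ : α → α → ℝ)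
    (ψ : ℝ × α → ℝ) (z : ℝ × α) : ℝ :=
  Filter.limsup (fun y => max (ψ (z.1, y) - ψ z) 0 / ρ z.2 y) (nhdsWithin z.2 (s \ {z.2}))

/-- Spatial lower local slope. -/
noncomputable def lowerSlopeSpWrt {α : Type*} [TopologicalSpace α] (s : Set α) (ρ : α → α → ℝ)
    (ψ : ℝ × α → ℝ) (z : ℝ × α) : ℝ :=
  Filter.limsup (fun y => max (ψ z - ψ (z.1, y)) 0 / ρ z.2 y) (nhdsWithin z.2 (s \ {z.2}))

/-- Product (max) metric on `ℝ × α` built from `ρ`. -/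
def prodMet {α : Type*} (ρ : α → α → ℝ) : ℝ × α → ℝ × α → ℝ :=
  fun z w => max |z.1 - w.1| (ρ z.2 w.2)

/-- Metric viscosity subsolution of `∂ₜ u + H(t, x, u, |∇u|) = 0` on `(0,∞) × (s, ρ)`. -/
def IsMVSubsolutionTWrt {α : Type*} [TopologicalSpace α] (s : Set α) (ρ : α → α → ℝ)
    (H : ℝ → α → ℝ → ℝ → ℝ) (u : ℝ × α → ℝ) : Prop :=
  ∀ ψ₁ ψ₂ dψ₁ dψ₂ : ℝ × α → ℝ,
    LocLipWrt (Ioi (0:ℝ) ×ˢ s) (prodMet ρ) ψ₁ →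
    LocLipWrt (Ioi (0:ℝ) ×ˢ s) (prodMet ρ) ψ₂ →
    (∀ z ∈ Ioi (0:ℝ) ×ˢ s, HasDerivAt (fun τ => ψ₁ (τ, z.2)) (dψ₁ z) z.1) →
    ContinuousOn dψ₁ (Ioi (0:ℝ) ×ˢ s) →
    (∀ z ∈ Ioi (0:ℝ) ×ˢ s, HasDerivAt (fun τ => ψ₂ (τ, z.2)) (dψ₂ z) z.1) →
    ContinuousOn dψ₂ (Ioi (0:ℝ) ×ˢ s) →
    ContinuousOn (slopeSpWrt s ρ ψ₁) (Ioi (0:ℝ) ×ˢ s) →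
    (∀ z ∈ Ioi (0:ℝ) ×ˢ s, lowerSlopeSpWrt s ρ ψ₁ z = slopeSpWrt s ρ ψ₁ z) →
    ∀ z ∈ Ioi (0:ℝ) ×ˢ s,
      IsLocalMaxOn (fun w => uscWrt (Ioi (0:ℝ) ×ˢ s) u w - (ψ₁ w + ψ₂ w))
        (Ioi (0:ℝ) ×ˢ s) z →
      dψ₁ z + dψ₂ z +
        Hlow (fun w : ℝ × α => H w.1 w.2)
          (uscWrt (Ioi (0:ℝ) ×ˢ s) (slopeSpWrt s ρ ψ₂) z) z
          (uscWrt (Ioi (0:ℝ) ×ˢ s) u z) (slopeSpWrt s ρ ψ₁ z) ≤ 0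

/-- Metric viscosity supersolution of `∂ₜ u + H(t, x, u, |∇u|) = 0` on `(0,∞) × (s, ρ)`. -/
def IsMVSupersolutionTWrt {α : Type*} [TopologicalSpace α] (s : Set α) (ρ : α → α → ℝ)
    (H : ℝ → α → ℝ → ℝ → ℝ) (u : ℝ × α → ℝ) : Prop :=
  ∀ ψ₁ ψ₂ dψ₁ dψ₂ : ℝ × α → ℝ,
    LocLipWrt (Ioi (0:ℝ) ×ˢ s) (prodMet ρ) ψ₁ →
    LocLipWrt (Ioi (0:ℝ) ×ˢ s) (prodMet ρ) ψ₂ →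
    (∀ z ∈ Ioi (0:ℝ) ×ˢ s, HasDerivAt (fun τ => ψ₁ (τ, z.2)) (dψ₁ z) z.1) →
    ContinuousOn dψ₁ (Ioi (0:ℝ) ×ˢ s) →
    (∀ z ∈ Ioi (0:ℝ) ×ˢ s, HasDerivAt (fun τ => ψ₂ (τ, z.2)) (dψ₂ z) z.1) →
    ContinuousOn dψ₂ (Ioi (0:ℝ) ×ˢ s) →
    ContinuousOn (slopeSpWrt s ρ ψ₁) (Ioi (0:ℝ) ×ˢ s) →
    (∀ z ∈ Ioi (0:ℝ) ×ˢ s, upperSlopeSpWrt s ρ ψ₁ z = slopeSpWrt s ρ ψ₁ z) →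
    ∀ z ∈ Ioi (0:ℝ) ×ˢ s,
      IsLocalMinOn (fun w => lscWrt (Ioi (0:ℝ) ×ˢ s) u w - (ψ₁ w + ψ₂ w))
        (Ioi (0:ℝ) ×ˢ s) z →
      0 ≤ dψ₁ z + dψ₂ z +
        Hupp (fun w : ℝ × α => H w.1 w.2)
          (uscWrt (Ioi (0:ℝ) ×ˢ s) (slopeSpWrt s ρ ψ₂) z) z
          (lscWrt (Ioi (0:ℝ) ×ˢ s) u z) (slopeSpWrt s ρ ψ₁ z)

section Limsup

theorem limsup_mem_Icc_of_eventually {β : Type*} {F : Filter β} {g : β → ℝ} {K : ℝ} (hK : 0 ≤ K)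
    (h0 : ∀ᶠ y in F, 0 ≤ g y) (h : ∀ᶠ y in F, g y ≤ K) : limsup g F ∈ Icc 0 K := by
  rcases F.eq_or_neBot with rfl | hF
  · simp [limsup, limsSup, hK]
  · exact ⟨le_limsup_of_frequently_le h0.frequently (isBoundedUnder_of_eventually_le h),
      limsup_le_of_le (isCoboundedUnder_le_of_eventually_le F h0) h⟩

theorem limsup_eq_of_forall_pos {β : Type*} {F : Filter β} {g : β → ℝ} {c : ℝ} (hc : 0 ≤ c)
    (h0 : ∀ᶠ y in F, 0 ≤ g y) (hle : ∀ ε > 0, ∀ᶠ y in F, g y ≤ c + ε)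
    (hge : 0 < c → ∀ ε > 0, ∃ᶠ y in F, c - ε ≤ g y) : limsup g F = c := by
  apply le_antisymm
  · refine le_of_forall_pos_le_add fun ε hε => ?_
    exact (limsup_mem_Icc_of_eventually (by linarith) h0 (hle ε hε)).2
  · rcases hc.eq_or_lt with rfl | hc'
    · exact (limsup_mem_Icc_of_eventually zero_le_one h0 (by simpa using hle 1 one_pos)).1
    · refine le_of_forall_pos_le_add fun ε hε => ?_
      have := le_limsup_of_frequently_le (hge hc' ε hε) (isBoundedUnder_of_eventually_le (hle 1 one_pos))
      linarith

end Limsup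

section LowerEnvelope

variable {α : Type*} [TopologicalSpace α] {s : Set α} {u : α → ℝ} {C : ℝ} {x : α}

theorem eventually_nhdsWithin_abs_le (hu : ∀ y ∈ s, |u y| ≤ C) (x : α) :
    (∀ᶠ y in 𝓝[s] x, -C ≤ u y) ∧ ∀ᶠ y in 𝓝[s] x, u y ≤ C :=
  ⟨eventually_nhdsWithin_of_forall fun y hy => (abs_le.1 (hu y hy)).1,
    eventually_nhdsWithin_of_forall fun y hy => (abs_le.1 (hu y hy)).2⟩

theorem le_lscWrt (hu : ∀ y ∈ s, |u y| ≤ C) (hx : x ∈ s) {b : ℝ}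
    (hb : ∀ᶠ y in 𝓝[s] x, b ≤ u y) : b ≤ lscWrt s u x := by
  have := mem_closure_iff_nhdsWithin_neBot.1 (subset_closure hx)
  exact le_liminf_of_le
    (isCoboundedUnder_ge_of_eventually_le _ (eventually_nhdsWithin_abs_le hu x).2) hb

theorem lscWrt_le_of_frequently (hu : ∀ y ∈ s, |u y| ≤ C) {b : ℝ}
    (hb : ∃ᶠ y in 𝓝[s] x, u y ≤ b) : lscWrt s u x ≤ b :=
  liminf_le_of_frequently_le hb
    (isBoundedUnder_of_eventually_ge (eventually_nhdsWithin_abs_le hu x).1)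

theorem lscWrt_le (hu : ∀ y ∈ s, |u y| ≤ C) (hx : x ∈ s) : lscWrt s u x ≤ u x := by
  refine lscWrt_le_of_frequently hu fun h => ?_
  exact (mem_of_mem_nhdsWithin hx h) le_rfl

theorem abs_lscWrt_le (hu : ∀ y ∈ s, |u y| ≤ C) (hx : x ∈ s) : |lscWrt s u x| ≤ C :=
  abs_le.2 ⟨le_lscWrt hu hx (eventually_nhdsWithin_abs_le hu x).1,
    (lscWrt_le hu hx).trans (abs_le.1 (hu x hx)).2⟩

theorem eventually_lt_of_lt_lscWrt (hu : ∀ y ∈ s, |u y| ≤ C) {b : ℝ} (hb : b < lscWrt s u x) :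
    ∀ᶠ y in 𝓝[s] x, b < u y :=
  eventually_lt_of_lt_liminf hb
    (isBoundedUnder_of_eventually_ge (eventually_nhdsWithin_abs_le hu x).1)

theorem frequently_lt_of_lscWrt_lt (hu : ∀ y ∈ s, |u y| ≤ C) (hx : x ∈ s) {b : ℝ}
    (hb : lscWrt s u x < b) : ∃ᶠ y in 𝓝[s] x, u y < b := by
  intro h
  exact absurd (le_lscWrt hu hx (h.mono fun y hy => not_lt.1 hy)) (not_le.2 hb)

theorem lowerSemicontinuousOn_lscWrt (hu : ∀ y ∈ s, |u y| ≤ C) :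
    LowerSemicontinuousOn (lscWrt s u) s := by
  intro x hx b hb
  obtain ⟨b', hb₁, hb₂⟩ := exists_between hb
  have h := eventually_eventually_nhdsWithin.2 (eventually_lt_of_lt_lscWrt hu hb₂)
  filter_upwards [h, self_mem_nhdsWithin] with y hy hys
  exact hb₁.trans_le (le_lscWrt hu hys (hy.mono fun _ h => h.le))

end LowerEnvelope

namespace IsMetricOn

variable {Y : Type*} [MetricSpace Y] {s : Set Y} {ρ : Y → Y → ℝ}

theorem nonneg (h : IsMetricOn s ρ) {x y : Y} (hx : x ∈ s) (hy : y ∈ s) : 0 ≤ ρ x y :=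
  dist_nonneg.trans (h.ge_dist x hx y hy)

theorem pos (h : IsMetricOn s ρ) {x y : Y} (hx : x ∈ s) (hy : y ∈ s) (hne : x ≠ y) :
    0 < ρ x y :=
  (dist_pos.2 hne).trans_le (h.ge_dist x hx y hy)

theorem abs_sub_le (h : IsMetricOn s ρ) {x y z : Y} (hx : x ∈ s) (hy : y ∈ s) (hz : z ∈ s) :
    |ρ x z - ρ y z| ≤ ρ x y := by
  have h₁ := h.triangle x hx y hy z hz
  have h₂ := h.triangle y hy x hx z hz
  rw [h.symm y hy x hx] at h₂
  rw [abs_le]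
  constructor <;> linarith

theorem eventually_lt (h : IsMetricOn s ρ) {x : Y} (hx : x ∈ s) {ε : ℝ} (hε : 0 < ε) :
    ∀ᶠ y in 𝓝[s] x, ρ x y < ε :=
  mem_of_superset ((h.nhds_basis x hx).mem_of_mem hε) fun _ hy => hy.2

theorem tendsto_center (h : IsMetricOn s ρ) {x : Y} (hx : x ∈ s) :
    Tendsto (fun y => ρ x y) (𝓝[s] x) (𝓝 0) := by
  rw [tendsto_order]
  refine ⟨fun a ha => ?_, fun a ha => h.eventually_lt hx ha⟩
  filter_upwards [self_mem_nhdsWithin] with y hy using ha.trans_le (h.nonneg hx hy)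

theorem continuousOn_left (h : IsMetricOn s ρ) {y : Y} (hy : y ∈ s) :
    ContinuousOn (fun x => ρ x y) s := by
  intro x hx
  refine tendsto_iff_dist_tendsto_zero.2 ?_
  refine squeeze_zero' (Eventually.of_forall fun _ => dist_nonneg) ?_ (h.tendsto_center hx)
  filter_upwards [self_mem_nhdsWithin] with w hw
  rw [Real.dist_eq, abs_sub_comm]
  exact h.abs_sub_le hx hw hy

theorem prodMet_nonneg (h : IsMetricOn s ρ) {z w : ℝ × Y} (hz : z.2 ∈ s) (hw : w.2 ∈ s) :
    0 ≤ prodMet ρ z w := (h.nonneg hz hw).trans (le_max_right _ _)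

theorem tendsto_prodMet (h : IsMetricOn s ρ) {I : Set ℝ} {z : ℝ × Y} (hz : z.2 ∈ s) :
    Tendsto (fun w => prodMet ρ w z) (𝓝[I ×ˢ s] z) (𝓝 0) := by
  have h₂ : Tendsto (Prod.snd : ℝ × Y → Y) (𝓝[I ×ˢ s] z) (𝓝[s] z.2) :=
    tendsto_nhdsWithin_of_tendsto_nhds_of_eventually_within _
      (continuous_snd.continuousAt.mono_left nhdsWithin_le_nhds)
      (eventually_nhdsWithin_of_forall fun w hw => hw.2)
  have h₁ : Tendsto (fun w : ℝ × Y => |w.1 - z.1|) (𝓝[I ×ˢ s] z) (𝓝 0) := by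
    have : ContinuousAt (fun w : ℝ × Y => |w.1 - z.1|) z := by fun_prop
    simpa using this.tendsto.mono_left (nhdsWithin_le_nhds (s := I ×ˢ s))
  have h₃ : Tendsto (fun w : ℝ × Y => ρ w.2 z.2) (𝓝[I ×ˢ s] z) (𝓝 0) := by
    have := (h.continuousOn_left hz z.2 hz).tendsto.comp h₂
    simpa [h.refl z.2 hz, Function.comp_def] using this
  simpa [prodMet] using h₁.max h₃

/-- A property holding near `z` holds on a box for the metric `ρ`. -/
theorem exists_box (h : IsMetricOn s ρ) {z : ℝ × Y} (hz : z ∈ Ioi (0 : ℝ) ×ˢ s)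
    {P : ℝ × Y → Prop} (hP : ∀ᶠ w in 𝓝[Ioi (0 : ℝ) ×ˢ s] z, P w) :
    ∃ R > 0, ∀ t, |t - z.1| < R → 0 < t ∧ ∀ x ∈ s, ρ z.2 x < R → P (t, x) := by
  obtain ⟨R, hR, hsub⟩ := Metric.mem_nhdsWithin_iff.1 hP
  have hz1 : 0 < z.1 := hz.1
  refine ⟨min R z.1, lt_min hR hz1, fun t ht => ?_⟩
  have ht0 : 0 < t := by
    have := (abs_lt.1 (ht.trans_le (min_le_right _ _))).1
    linarith
  refine ⟨ht0, fun x hx hxR => hsub ⟨?_, ht0, hx⟩⟩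
  rw [Metric.mem_ball, Prod.dist_eq, max_lt_iff]
  refine ⟨ht.trans_le (min_le_left _ _), ?_⟩
  rw [dist_comm]
  exact (h.ge_dist _ hz.2 _ hx).trans_lt (hxR.trans_le (min_le_left _ _))

end IsMetricOn

section Slopes

variable {Y : Type*} [MetricSpace Y] {s : Set Y} {ρ : Y → Y → ℝ} {ψ : ℝ × Y → ℝ}

theorem LocLipWrt.exists_nonneg (hm : IsMetricOn s ρ)
    (hψ : LocLipWrt (Ioi (0 : ℝ) ×ˢ s) (prodMet ρ) ψ) {z : ℝ × Y} (hz : z ∈ Ioi (0 : ℝ) ×ˢ s) :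
    ∃ K ≥ 0, ∃ t ∈ 𝓝[Ioi (0 : ℝ) ×ˢ s] z, t ⊆ Ioi (0 : ℝ) ×ˢ s ∧
      ∀ y ∈ t, ∀ w ∈ t, |ψ y - ψ w| ≤ K * prodMet ρ y w := by
  obtain ⟨K, t, ht, h⟩ := hψ z hz
  refine ⟨max K 0, le_max_right _ _, t ∩ (Ioi (0 : ℝ) ×ˢ s), inter_mem ht self_mem_nhdsWithin,
    inter_subset_right, fun y hy w hw => (h y hy w hw).trans ?_⟩
  exact mul_le_mul_of_nonneg_right (le_max_left _ _) (hm.prodMet_nonneg hy.2.2 hw.2.2)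

theorem LocLipWrt.continuousOn_prodMet (hm : IsMetricOn s ρ)
    (hψ : LocLipWrt (Ioi (0 : ℝ) ×ˢ s) (prodMet ρ) ψ) : ContinuousOn ψ (Ioi (0 : ℝ) ×ˢ s) := by
  intro z hz
  obtain ⟨K, hK, t, ht, hts, h⟩ := hψ.exists_nonneg hm hz
  refine tendsto_iff_dist_tendsto_zero.2 ?_
  have h0 : Tendsto (fun w => K * prodMet ρ w z) (𝓝[Ioi (0 : ℝ) ×ˢ s] z) (𝓝 0) := by
    simpa using (hm.tendsto_prodMet hz.2).const_mul K
  refine squeeze_zero' (Eventually.of_forall fun _ => dist_nonneg) ?_ h0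
  filter_upwards [ht] with w hw
  exact h w hw z (mem_of_mem_nhdsWithin hz ht)

theorem tendsto_prodMk_nhdsWithin {w : ℝ × Y} (hw : w ∈ Ioi (0 : ℝ) ×ˢ s) :
    Tendsto (fun y => (w.1, y)) (𝓝[s] w.2) (𝓝[Ioi (0 : ℝ) ×ˢ s] w) := by
  refine tendsto_nhdsWithin_of_tendsto_nhds_of_eventually_within _ ?_
    (eventually_nhdsWithin_of_forall fun y hy => ⟨hw.1, hy⟩)
  have : Continuous fun y : Y => (w.1, y) := by fun_prop
  exact (this.tendsto w.2).mono_left nhdsWithin_le_nhds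

theorem LocLipWrt.eventually_slice (hm : IsMetricOn s ρ)
    (hψ : LocLipWrt (Ioi (0 : ℝ) ×ˢ s) (prodMet ρ) ψ) {z : ℝ × Y} (hz : z ∈ Ioi (0 : ℝ) ×ˢ s) :
    ∃ K ≥ 0, ∀ᶠ w in 𝓝[Ioi (0 : ℝ) ×ˢ s] z, ∀ᶠ y in 𝓝[s \ {w.2}] w.2,
      |ψ (w.1, y) - ψ w| / ρ w.2 y ≤ K := by
  obtain ⟨K, hK, t, ht, hts, h⟩ := hψ.exists_nonneg hm hz
  refine ⟨K, hK, ?_⟩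
  filter_upwards [eventually_eventually_nhdsWithin.2 ht, ht, self_mem_nhdsWithin] with w hw hwt hws
  have h₁ := (tendsto_prodMk_nhdsWithin hws).eventually hw
  filter_upwards [h₁.filter_mono (nhdsWithin_mono _ sdiff_subset), self_mem_nhdsWithin] with y hy hys
  have hpos : 0 < ρ w.2 y := hm.pos hws.2 hys.1 fun e => hys.2 e.symm
  rw [div_le_iff₀ hpos]
  have := h _ hy _ hwt
  have hmax : prodMet ρ (w.1, y) w = ρ w.2 y := by
    simp [prodMet, hm.symm y hys.1 w.2 hws.2, hpos.le]
  rwa [hmax] at this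

theorem eventually_quotient_nonneg (hm : IsMetricOn s ρ) (g : Y → ℝ) (hg : ∀ y, 0 ≤ g y) {x : Y}
    (hx : x ∈ s) : ∀ᶠ y in 𝓝[s \ {x}] x, 0 ≤ g y / ρ x y := by
  filter_upwards [self_mem_nhdsWithin] with y hy
  exact div_nonneg (hg y) (hm.nonneg hx hy.1)

theorem LocLipWrt.eventually_slopeSpWrt_mem (hm : IsMetricOn s ρ)
    (hψ : LocLipWrt (Ioi (0 : ℝ) ×ˢ s) (prodMet ρ) ψ) {z : ℝ × Y} (hz : z ∈ Ioi (0 : ℝ) ×ˢ s) :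
    ∃ K ≥ 0, ∀ᶠ w in 𝓝[Ioi (0 : ℝ) ×ˢ s] z, slopeSpWrt s ρ ψ w ∈ Icc 0 K := by
  obtain ⟨K, hK, h⟩ := hψ.eventually_slice hm hz
  refine ⟨K, hK, ?_⟩
  filter_upwards [h, self_mem_nhdsWithin] with w hw hws
  exact limsup_mem_Icc_of_eventually hK
    (eventually_quotient_nonneg hm _ (fun _ => abs_nonneg _) hws.2) hw

theorem LocLipWrt.slopeSpWrt_nonneg (hm : IsMetricOn s ρ)
    (hψ : LocLipWrt (Ioi (0 : ℝ) ×ˢ s) (prodMet ρ) ψ) {z : ℝ × Y} (hz : z ∈ Ioi (0 : ℝ) ×ˢ s) :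
    0 ≤ slopeSpWrt s ρ ψ z := by
  obtain ⟨K, -, h⟩ := hψ.eventually_slopeSpWrt_mem hm hz
  exact (h.self_of_nhdsWithin hz).1

theorem LocLipWrt.eventually_lt_of_slopeSpWrt_lt (hm : IsMetricOn s ρ)
    (hψ : LocLipWrt (Ioi (0 : ℝ) ×ˢ s) (prodMet ρ) ψ) {z : ℝ × Y} (hz : z ∈ Ioi (0 : ℝ) ×ˢ s)
    {L : ℝ} (hL : slopeSpWrt s ρ ψ z < L) :
    ∀ᶠ y in 𝓝[s \ {z.2}] z.2, |ψ (z.1, y) - ψ z| / ρ z.2 y < L := by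
  obtain ⟨K, -, h⟩ := hψ.eventually_slice hm hz
  have h' : ∀ᶠ y in 𝓝[s \ {z.2}] z.2, |ψ (z.1, y) - ψ z| / ρ z.2 y ≤ K :=
    h.self_of_nhdsWithin hz
  exact eventually_lt_of_limsup_lt hL (isBoundedUnder_of_eventually_le h')

theorem LocLipWrt.eventually_slopeSpWrt_lt (hm : IsMetricOn s ρ)
    (hψ : LocLipWrt (Ioi (0 : ℝ) ×ˢ s) (prodMet ρ) ψ) {z : ℝ × Y} (hz : z ∈ Ioi (0 : ℝ) ×ˢ s)
    {L : ℝ} (hL : uscWrt (Ioi (0 : ℝ) ×ˢ s) (slopeSpWrt s ρ ψ) z < L) :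
    ∀ᶠ w in 𝓝[Ioi (0 : ℝ) ×ˢ s] z, slopeSpWrt s ρ ψ w < L := by
  obtain ⟨K, -, h⟩ := hψ.eventually_slopeSpWrt_mem hm hz
  exact eventually_lt_of_limsup_lt hL (isBoundedUnder_of_eventually_le (h.mono fun _ h => h.2))

theorem LocLipWrt.uscWrt_slopeSpWrt_nonneg (hm : IsMetricOn s ρ)
    (hψ : LocLipWrt (Ioi (0 : ℝ) ×ˢ s) (prodMet ρ) ψ) {z : ℝ × Y} (hz : z ∈ Ioi (0 : ℝ) ×ˢ s) :
    0 ≤ uscWrt (Ioi (0 : ℝ) ×ˢ s) (slopeSpWrt s ρ ψ) z := by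
  obtain ⟨K, hK, h⟩ := hψ.eventually_slopeSpWrt_mem hm hz
  exact (limsup_mem_Icc_of_eventually hK (h.mono fun _ h => h.1) (h.mono fun _ h => h.2)).1

theorem slopeSpWrt_le (hm : IsMetricOn s ρ) {z : ℝ × Y} (hz : z.2 ∈ s) {A : ℝ} (hA : 0 ≤ A)
    (h : ∀ y ∈ s, |ψ (z.1, y) - ψ z| ≤ A * ρ z.2 y) : slopeSpWrt s ρ ψ z ≤ A := by
  refine (limsup_mem_Icc_of_eventually hA
    (eventually_quotient_nonneg hm _ (fun _ => abs_nonneg _) hz) ?_).2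
  filter_upwards [self_mem_nhdsWithin] with y hy
  rw [div_le_iff₀ (hm.pos hz hy.1 fun e => hy.2 e.symm)]
  exact h y hy.1

/-- On a geodesic space, a bound on the slope integrates to a Lipschitz bound. -/
theorem LocLipWrt.sub_le_of_slopeSpWrt_lt (hm : IsMetricOn s ρ) (hg : IsGeodesicWrt s ρ)
    (hψ : LocLipWrt (Ioi (0 : ℝ) ×ˢ s) (prodMet ρ) ψ) {t : ℝ} (ht : 0 < t) {x y : Y} (hx : x ∈ s)
    (hy : y ∈ s) {L : ℝ} (hL : ∀ w ∈ s, ρ x w ≤ ρ x y → slopeSpWrt s ρ ψ (t, w) < L) :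
    ψ (t, y) - ψ (t, x) ≤ L * ρ x y := by
  obtain ⟨γ, hγ0, hγ1, hγs, hγ⟩ := hg x hx y hy
  have hl : 0 ≤ ρ x y := hm.nonneg hx hy
  have hγc : ContinuousOn γ (Icc 0 (ρ x y)) := by
    refine LipschitzOnWith.continuousOn (K := 1) (LipschitzOnWith.of_dist_le_mul ?_)
    intro a ha b hb
    simpa [Real.dist_eq, hγ a ha b hb] using hm.ge_dist _ (hγs a ha) _ (hγs b hb)
  have hfc : ContinuousOn (fun τ => ψ (t, γ τ)) (Icc 0 (ρ x y)) :=
    (hψ.continuousOn_prodMet hm).comp (continuousOn_const.prodMk hγc) fun τ hτ => ⟨ht, hγs τ hτ⟩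
  have key := image_le_of_liminf_slope_right_lt_deriv_boundary (f := fun τ => ψ (t, γ τ))
    (f' := fun τ => slopeSpWrt s ρ ψ (t, γ τ)) (a := 0) (b := ρ x y) hfc ?_
    (B := fun τ => ψ (t, x) + L * τ) (B' := fun _ => L) (by simp [hγ0]) ?_ ?_
    (right_mem_Icc.2 hl)
  · simp only [hγ1] at key
    linarith
  · intro τ hτ r hr
    have hτ' := Ico_subset_Icc_self hτ
    have hz : (t, γ τ) ∈ Ioi (0 : ℝ) ×ˢ s := ⟨ht, hγs τ hτ'⟩
    have hev := hψ.eventually_lt_of_slopeSpWrt_lt hm hz hr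
    have hI : Icc 0 (ρ x y) ∈ 𝓝[>] τ :=
      mem_of_superset (Ioc_mem_nhdsGT hτ.2) fun b hb => ⟨hτ.1.trans hb.1.le, hb.2⟩
    have hne : ∀ b ∈ Icc 0 (ρ x y), τ < b → γ b ≠ γ τ := by
      intro b hb hlt e
      have h₁ := hγ b hb τ hτ'
      rw [e, hm.refl _ (hγs τ hτ')] at h₁
      exact absurd (abs_eq_zero.1 h₁.symm) (by linarith)
    have htend : Tendsto γ (𝓝[>] τ) (𝓝[s \ {γ τ}] γ τ) := by
      refine tendsto_nhdsWithin_of_tendsto_nhds_of_eventually_within _ ?_ ?_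
      · refine (hγc τ hτ').mono_left ?_
        exact le_inf (nhdsWithin_le_nhds) (le_principal_iff.2 hI)
      · filter_upwards [hI, self_mem_nhdsWithin] with b hb hlt
        exact ⟨hγs b hb, hne b hb hlt⟩
    refine Eventually.frequently ?_
    filter_upwards [htend.eventually hev, hI, self_mem_nhdsWithin] with b hb hbI hlt
    have hlt' : 0 < b - τ := sub_pos.2 hlt
    have hρ : ρ (γ τ) (γ b) = b - τ := by
      rw [hγ τ hτ' b hbI, abs_sub_comm, abs_of_pos hlt']
    simp only [hρ] at hb
    rw [slope_def_field]
    refine lt_of_le_of_lt ?_ hb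
    exact div_le_div_of_nonneg_right (le_abs_self _) hlt'.le
  · intro τ
    simpa using ((hasDerivAt_id τ).const_mul L).const_add (ψ (t, x))
  · intro τ hτ _
    have hτ' := Ico_subset_Icc_self hτ
    refine hL _ (hγs τ hτ') ?_
    have := hγ 0 (left_mem_Icc.2 hl) τ hτ'
    rw [hγ0] at this
    rw [this, zero_sub, abs_neg, abs_of_nonneg hτ.1]
    exact hτ.2.le

end Slopes

section Barrier

variable {Y : Type*} [MetricSpace Y] {s : Set Y} {ρ : Y → Y → ℝ}

/-- Concave quadratic barrier centred at `y`. -/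
def quadBarrier (ρ : Y → Y → ℝ) (κ : ℝ) (y : Y) (w : ℝ × Y) : ℝ :=
  -(κ * ρ w.2 y ^ 2)

/-- Lipschitz barrier, conical in space and quadratic in time around `(t₀, x₀)`. -/
def coneBarrier (ρ : Y → Y → ℝ) (A m B t₀ : ℝ) (x₀ : Y) (w : ℝ × Y) : ℝ :=
  -(A * ρ w.2 x₀) + m * w.1 - B * (w.1 - t₀) ^ 2

theorem IsMetricOn.abs_sq_sub_sq_le (hm : IsMetricOn s ρ) {x w y : Y} (hx : x ∈ s) (hw : w ∈ s)
    (hy : y ∈ s) : |ρ w y ^ 2 - ρ x y ^ 2| ≤ (ρ w y + ρ x y) * ρ x w := by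
  have h₁ := hm.abs_sub_le hx hw hy
  rw [abs_sub_comm] at h₁
  have h₂ : 0 ≤ ρ w y + ρ x y := add_nonneg (hm.nonneg hw hy) (hm.nonneg hx hy)
  rw [sq_sub_sq, abs_mul, abs_of_nonneg h₂]
  exact mul_le_mul_of_nonneg_left h₁ h₂

theorem locLipWrt_quadBarrier (hm : IsMetricOn s ρ) {κ : ℝ} (hκ : 0 ≤ κ) {y : Y} (hy : y ∈ s) :
    LocLipWrt (Ioi (0 : ℝ) ×ˢ s) (prodMet ρ) (quadBarrier ρ κ y) := by
  intro z hz
  have hsnd : Tendsto (Prod.snd : ℝ × Y → Y) (𝓝[Ioi (0 : ℝ) ×ˢ s] z) (𝓝[s] z.2) :=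
    tendsto_nhdsWithin_of_tendsto_nhds_of_eventually_within _
      (continuous_snd.continuousAt.mono_left nhdsWithin_le_nhds)
      (eventually_nhdsWithin_of_forall fun w hw => hw.2)
  have hev : ∀ᶠ w in 𝓝[Ioi (0 : ℝ) ×ˢ s] z, ρ w.2 y < ρ z.2 y + 1 :=
    hsnd.eventually ((hm.continuousOn_left hy z.2 hz.2).eventually_lt_const (lt_add_one _))
  refine ⟨κ * (2 * (ρ z.2 y + 1)), _, hev, ?_⟩
  rintro v ⟨hv, hvs⟩ w ⟨hw, hws⟩
  have h₁ := hm.abs_sq_sub_sq_le hvs.2 hws.2 hy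
  have h₂ : ρ v.2 w.2 ≤ prodMet ρ v w := le_max_right _ _
  have h₃ := hm.nonneg hvs.2 hws.2
  have h₄ := hm.nonneg hz.2 hy
  have hw' : ρ w.2 y < ρ z.2 y + 1 := hw
  have hv' : ρ v.2 y < ρ z.2 y + 1 := hv
  calc |quadBarrier ρ κ y v - quadBarrier ρ κ y w|
      = κ * |ρ w.2 y ^ 2 - ρ v.2 y ^ 2| := by
        rw [quadBarrier, quadBarrier, ← abs_of_nonneg hκ, ← abs_mul, abs_of_nonneg hκ]
        ring_nf
    _ ≤ κ * ((ρ w.2 y + ρ v.2 y) * ρ v.2 w.2) := by gcongr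
    _ ≤ κ * ((2 * (ρ z.2 y + 1)) * prodMet ρ v w) := by
        gcongr
        linarith
    _ = κ * (2 * (ρ z.2 y + 1)) * prodMet ρ v w := by ring

theorem locLipWrt_coneBarrier (hm : IsMetricOn s ρ) {A : ℝ} (hA : 0 ≤ A) (m B t₀ : ℝ) {x₀ : Y}
    (hx₀ : x₀ ∈ s) :
    LocLipWrt (Ioi (0 : ℝ) ×ˢ s) (prodMet ρ) (coneBarrier ρ A m B t₀ x₀) := by
  intro z hz
  have hev : ∀ᶠ w in 𝓝[Ioi (0 : ℝ) ×ˢ s] z, |w.1 - t₀| < |z.1 - t₀| + 1 := by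
    have : ContinuousAt (fun w : ℝ × Y => |w.1 - t₀|) z := by fun_prop
    exact nhdsWithin_le_nhds (this.eventually_lt_const (lt_add_one _))
  refine ⟨A + |m| + |B| * (2 * (|z.1 - t₀| + 1)), _, hev, ?_⟩
  rintro v ⟨hv, hvs⟩ w ⟨hw, hws⟩
  have hv' : |v.1 - t₀| < |z.1 - t₀| + 1 := hv
  have hw' : |w.1 - t₀| < |z.1 - t₀| + 1 := hw
  have h₁ : |ρ v.2 x₀ - ρ w.2 x₀| ≤ prodMet ρ v w :=
    (hm.abs_sub_le hvs.2 hws.2 hx₀).trans (le_max_right _ _)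
  have h₂ : |v.1 - w.1| ≤ prodMet ρ v w := le_max_left _ _
  have h₃ : |(v.1 - t₀) + (w.1 - t₀)| ≤ 2 * (|z.1 - t₀| + 1) :=
    (abs_add_le _ _).trans (by linarith)
  have e : coneBarrier ρ A m B t₀ x₀ v - coneBarrier ρ A m B t₀ x₀ w
      = -(A * (ρ v.2 x₀ - ρ w.2 x₀)) + m * (v.1 - w.1)
        + -(B * (((v.1 - t₀) + (w.1 - t₀)) * (v.1 - w.1))) := by
    simp only [coneBarrier]; ring
  rw [e]
  refine (abs_add_three _ _ _).trans ?_
  simp only [abs_neg, abs_mul, abs_of_nonneg hA]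
  have h0 := hm.prodMet_nonneg hvs.2 hws.2
  calc A * |ρ v.2 x₀ - ρ w.2 x₀| + |m| * |v.1 - w.1|
        + |B| * (|(v.1 - t₀) + (w.1 - t₀)| * |v.1 - w.1|)
      ≤ A * prodMet ρ v w + |m| * prodMet ρ v w
        + |B| * (2 * (|z.1 - t₀| + 1) * prodMet ρ v w) := by gcongr
    _ = _ := by ring

theorem slopeSpWrt_quadBarrier (hm : IsMetricOn s ρ) (hg : IsGeodesicWrt s ρ) {κ : ℝ}
    (hκ : 0 ≤ κ) {y : Y} (hy : y ∈ s) {z : ℝ × Y} (hz : z.2 ∈ s) :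
    slopeSpWrt s ρ (quadBarrier ρ κ y) z = 2 * κ * ρ z.2 y ∧
      upperSlopeSpWrt s ρ (quadBarrier ρ κ y) z = 2 * κ * ρ z.2 y := by
  have hl : 0 ≤ ρ z.2 y := hm.nonneg hz hy
  have hc : 0 ≤ 2 * κ * ρ z.2 y := by positivity
  have hpos : ∀ w ∈ s \ {z.2}, 0 < ρ z.2 w := fun w hw =>
    hm.pos hz hw.1 fun e => hw.2 e.symm
  have hle : ∀ ε > 0, ∀ᶠ w in 𝓝[s \ {z.2}] z.2,
      |quadBarrier ρ κ y (z.1, w) - quadBarrier ρ κ y z| / ρ z.2 w ≤ 2 * κ * ρ z.2 y + ε := by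
    intro ε hε
    have h₁ : ∀ᶠ w in 𝓝[s] z.2, ρ z.2 w < ε / (κ + 1) := hm.eventually_lt hz (by positivity)
    filter_upwards [h₁.filter_mono (nhdsWithin_mono _ sdiff_subset), self_mem_nhdsWithin] with w hw hws
    have hp := hpos w hws
    rw [div_le_iff₀ hp]
    have h₂ := hm.abs_sq_sub_sq_le hz hws.1 hy
    have h₃ : ρ w y ≤ ρ z.2 y + ρ z.2 w := by
      have := hm.triangle w hws.1 z.2 hz y hy
      rw [hm.symm w hws.1 z.2 hz] at this
      linarith
    have h₄ : κ * ρ z.2 w ≤ ε := by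
      have := (lt_div_iff₀ (by positivity)).1 hw
      nlinarith
    calc |quadBarrier ρ κ y (z.1, w) - quadBarrier ρ κ y z|
        = κ * |ρ w y ^ 2 - ρ z.2 y ^ 2| := by
          rw [← abs_of_nonneg hκ, ← abs_mul, abs_of_nonneg hκ, ← abs_neg]
          simp only [quadBarrier]
          ring_nf
      _ ≤ κ * ((ρ w y + ρ z.2 y) * ρ z.2 w) := by gcongr
      _ ≤ κ * ((ρ z.2 y + ρ z.2 w + ρ z.2 y) * ρ z.2 w) := by gcongr
      _ = (2 * κ * ρ z.2 y + κ * ρ z.2 w) * ρ z.2 w := by ring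
      _ ≤ (2 * κ * ρ z.2 y + ε) * ρ z.2 w := by gcongr
  have hmono : ∀ w ∈ s \ {z.2},
      max (quadBarrier ρ κ y (z.1, w) - quadBarrier ρ κ y z) 0 / ρ z.2 w ≤
      |quadBarrier ρ κ y (z.1, w) - quadBarrier ρ κ y z| / ρ z.2 w := fun w hw =>
    div_le_div_of_nonneg_right (max_le (le_abs_self _) (abs_nonneg _)) (hpos w hw).le
  have hge : 0 < 2 * κ * ρ z.2 y → ∀ ε > 0, ∃ᶠ w in 𝓝[s \ {z.2}] z.2,
      2 * κ * ρ z.2 y - ε ≤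
        max (quadBarrier ρ κ y (z.1, w) - quadBarrier ρ κ y z) 0 / ρ z.2 w := by
    intro hc' ε hε
    have hl' : 0 < ρ z.2 y := by
      rcases hl.eq_or_lt with h | h
      · simp [← h] at hc'
      · exact h
    obtain ⟨γ, hγ0, hγ1, hγs, hγ⟩ := hg z.2 hz y hy
    have hρ : ∀ b ∈ Icc 0 (ρ z.2 y), ρ z.2 (γ b) = b ∧ ρ (γ b) y = ρ z.2 y - b := by
      intro b hb
      have h₁ := hγ 0 (left_mem_Icc.2 hl) b hb
      have h₂ := hγ b hb _ (right_mem_Icc.2 hl)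
      rw [hγ0, zero_sub, abs_neg, abs_of_nonneg hb.1] at h₁
      rw [hγ1, abs_sub_comm, abs_of_nonneg (sub_nonneg.2 hb.2)] at h₂
      exact ⟨h₁, h₂⟩
    have hIcc : Ioc 0 (ρ z.2 y) ∈ 𝓝[>] (0 : ℝ) := Ioc_mem_nhdsGT hl'
    have htend : Tendsto γ (𝓝[>] 0) (𝓝[s \ {z.2}] z.2) := by
      refine tendsto_nhdsWithin_of_tendsto_nhds_of_eventually_within _ ?_ ?_
      · refine tendsto_iff_dist_tendsto_zero.2 (squeeze_zero' (g := fun b : ℝ => b)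
          (Eventually.of_forall fun _ => dist_nonneg) ?_ nhdsWithin_le_nhds)
        filter_upwards [hIcc] with b hb
        have hb' := Ioc_subset_Icc_self hb
        rw [dist_comm]
        exact (hm.ge_dist _ hz _ (hγs b hb')).trans (hρ b hb').1.le
      · filter_upwards [hIcc] with b hb
        have hb' := Ioc_subset_Icc_self hb
        refine ⟨hγs b hb', fun e => ?_⟩
        have h₁ := (hρ b hb').1
        rw [mem_singleton_iff.1 e, hm.refl _ hz] at h₁
        exact absurd h₁ hb.1.ne
    refine htend.frequently (Eventually.frequently ?_)
    have hsmall : ∀ᶠ b in 𝓝[>] (0 : ℝ), κ * b < ε := by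
      have : ContinuousAt (fun b : ℝ => κ * b) 0 := by fun_prop
      exact nhdsWithin_le_nhds (this.eventually_lt_const (by simpa using hε))
    filter_upwards [hIcc, hsmall] with b hb hbε
    obtain ⟨h₁, h₂⟩ := hρ b (Ioc_subset_Icc_self hb)
    rw [h₁, le_div_iff₀ hb.1]
    refine le_max_of_le_left ?_
    simp only [quadBarrier, h₂]
    nlinarith [hb.1]
  refine ⟨limsup_eq_of_forall_pos hc
      (eventually_quotient_nonneg hm _ (fun _ => abs_nonneg _) hz) hle fun h ε hε => ?_,
    limsup_eq_of_forall_pos hc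
      (eventually_quotient_nonneg hm _ (fun _ => le_max_right _ _) hz) (fun ε hε => ?_) hge⟩
  · refine ((hge h ε hε).and_eventually self_mem_nhdsWithin).mono fun w hw => ?_
    exact hw.1.trans (hmono w hw.2)
  · filter_upwards [hle ε hε, self_mem_nhdsWithin] with w hw hws
    exact (hmono w hws).trans hw

/-- Testing a supersolution with the barriers, the supremum in the definition being approximated by
a momentum `q`. -/
theorem IsMVSupersolutionTWrt.exists_of_isLocalMinOn (hm : IsMetricOn s ρ)
    (hg : IsGeodesicWrt s ρ) {H : ℝ → Y → ℝ → ℝ → ℝ} {u : ℝ × Y → ℝ}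
    (hu : IsMVSupersolutionTWrt s ρ H u) {κ A m B t₀ : ℝ} (hκ : 0 ≤ κ) (hA : 0 ≤ A) {y x₀ : Y}
    (hy : y ∈ s) (hx₀ : x₀ ∈ s) {z : ℝ × Y} (hz : z ∈ Ioi (0 : ℝ) ×ˢ s)
    (hmin : IsLocalMinOn (fun w => lscWrt (Ioi (0 : ℝ) ×ˢ s) u w -
      (quadBarrier ρ κ y w + coneBarrier ρ A m B t₀ x₀ w)) (Ioi (0 : ℝ) ×ˢ s) z)
    {η : ℝ} (hη : 0 < η) :
    ∃ q, 0 ≤ q ∧ |q - 2 * κ * ρ z.2 y| ≤ A ∧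
      -η < m - 2 * B * (z.1 - t₀) + H z.1 z.2 (lscWrt (Ioi (0 : ℝ) ×ˢ s) u z) q := by
  have hlip := locLipWrt_coneBarrier hm hA m B t₀ hx₀
  have hslope : EqOn (slopeSpWrt s ρ (quadBarrier ρ κ y)) (fun w => 2 * κ * ρ w.2 y)
      (Ioi (0 : ℝ) ×ˢ s) := fun w hw => (slopeSpWrt_quadBarrier hm hg hκ hy hw.2).1
  have key := hu (quadBarrier ρ κ y) (coneBarrier ρ A m B t₀ x₀) (fun _ => 0)
    (fun w => m - 2 * B * (w.1 - t₀)) (locLipWrt_quadBarrier hm hκ hy) hlip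
    (fun w _ => hasDerivAt_const w.1 (quadBarrier ρ κ y w)) continuousOn_const ?_ (by fun_prop) ?_ ?_ z hz hmin
  · have ha : uscWrt (Ioi (0 : ℝ) ×ˢ s) (slopeSpWrt s ρ (coneBarrier ρ A m B t₀ x₀)) z ∈ Icc 0 A := by
      refine limsup_mem_Icc_of_eventually hA ?_ ?_
      · exact eventually_nhdsWithin_of_forall fun w hw => hlip.slopeSpWrt_nonneg hm hw
      · refine eventually_nhdsWithin_of_forall fun w hw => slopeSpWrt_le hm hw.2 hA fun x hx => ?_
        have := hm.abs_sub_le hw.2 hx hx₀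
        calc |coneBarrier ρ A m B t₀ x₀ (w.1, x) - coneBarrier ρ A m B t₀ x₀ w|
            = A * |ρ w.2 x₀ - ρ x x₀| := by
              rw [← abs_of_nonneg hA, ← abs_mul, abs_of_nonneg hA]
              simp only [coneBarrier]
              ring_nf
          _ ≤ A * ρ w.2 x := by gcongr
    rw [hslope hz] at key
    have hp : 0 ≤ 2 * κ * ρ z.2 y := by have := hm.nonneg hz.2 hy; positivity
    have hne : ((fun w : ℝ × Y => H w.1 w.2) z (lscWrt (Ioi (0 : ℝ) ×ˢ s) u z) ''
        {q | 0 ≤ q ∧ |q - 2 * κ * ρ z.2 y| ≤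
          uscWrt (Ioi (0 : ℝ) ×ˢ s) (slopeSpWrt s ρ (coneBarrier ρ A m B t₀ x₀)) z}).Nonempty :=
      ⟨_, _, ⟨hp, by simpa using ha.1⟩, rfl⟩
    unfold Hupp at key
    obtain ⟨_, ⟨q, ⟨hq0, hq⟩, rfl⟩, hlt⟩ := exists_lt_of_lt_csSup hne (sub_lt_self _ hη)
    refine ⟨q, hq0, hq.trans ha.2, ?_⟩
    simp only at hlt key
    linarith
  · intro w _
    have h₁ := ((hasDerivAt_id w.1).const_mul m).const_add (-(A * ρ w.2 x₀))
    have h₂ := (((hasDerivAt_id w.1).sub_const t₀).pow 2).const_mul B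
    have h : HasDerivAt (fun τ => coneBarrier ρ A m B t₀ x₀ (τ, w.2)) _ w.1 := h₁.sub h₂
    refine h.congr_deriv ?_
    simp only [id_eq, Nat.cast_ofNat]
    ring
  · refine ContinuousOn.congr ?_ hslope
    exact continuousOn_const.mul
      ((hm.continuousOn_left hy).comp continuousOn_snd fun w hw => hw.2)
  · intro w hw
    rw [hslope hw]
    exact (slopeSpWrt_quadBarrier hm hg hκ hy hw.2).2

end Barrier

section Extend

variable {Z : Type*} {φ : ℕ → ℕ} {a b : ℕ → Z}

theorem extend_mem {S : ℕ → Set Z} (hφ : StrictMono φ) (ha : ∀ k, a k ∈ S (φ k))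
    (hb : ∀ n, b n ∈ S n) (n : ℕ) : Function.extend φ a b n ∈ S n := by
  by_cases h : ∃ k, φ k = n
  · obtain ⟨k, rfl⟩ := h
    rw [hφ.injective.extend_apply]
    exact ha k
  · rw [Function.extend_apply' _ _ _ h]
    exact hb n

theorem tendsto_extend [TopologicalSpace Z] {z : Z} (hφ : StrictMono φ)
    (ha : Tendsto a atTop (𝓝 z)) (hb : Tendsto b atTop (𝓝 z)) :
    Tendsto (Function.extend φ a b) atTop (𝓝 z) := by
  intro U hU
  obtain ⟨N, hN⟩ := eventually_atTop.1 (ha.eventually hU)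
  change ∀ᶠ n in atTop, Function.extend φ a b n ∈ U
  filter_upwards [hb.eventually hU, eventually_ge_atTop (φ N)] with n hn hle
  by_cases h : ∃ k, φ k = n
  · obtain ⟨k, rfl⟩ := h
    rw [hφ.injective.extend_apply]
    exact hN k (hφ.le_iff_le.1 hle)
  · rwa [Function.extend_apply' _ _ _ h]

end Extend

/-- The lower semilimit `inf { liminf u n (t n, x n) }` over sequences `(t n, x n) → z`
with `x n ∈ X n`. -/
noncomputable def lowerSemilimit {Y : Type*} [TopologicalSpace Y] (X : ℕ → Set Y)
    (u : ℕ → ℝ × Y → ℝ) (z : ℝ × Y) : ℝ :=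
  sInf {L : ℝ | ∃ tn : ℕ → ℝ, ∃ xn : ℕ → Y, (∀ n, xn n ∈ X n) ∧
    Tendsto tn atTop (𝓝 z.1) ∧ Tendsto xn atTop (𝓝 z.2) ∧
    Filter.liminf (fun n => u n (tn n, xn n)) atTop = L}

section Bounded

variable {Y : Type*} {X : ℕ → Set Y} {u : ℕ → ℝ × Y → ℝ} {C : ℝ}

theorem eventually_abs_le_of_tendsto {t : ℝ} (ht₀ : 0 < t)
    (hbdd : ∀ n, ∀ w ∈ Ioi (0 : ℝ) ×ˢ X n, |u n w| ≤ C) {tn : ℕ → ℝ} {xn : ℕ → Y}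
    (hxn : ∀ n, xn n ∈ X n) (ht : Tendsto tn atTop (𝓝 t)) :
    (∀ᶠ n in atTop, -C ≤ u n (tn n, xn n)) ∧ ∀ᶠ n in atTop, u n (tn n, xn n) ≤ C := by
  have h : ∀ᶠ n in atTop, |u n (tn n, xn n)| ≤ C := by
    filter_upwards [ht.eventually_const_lt ht₀] with n hn using hbdd n _ ⟨hn, hxn n⟩
  exact ⟨h.mono fun _ h => (abs_le.1 h).1, h.mono fun _ h => (abs_le.1 h).2⟩

theorem liminf_mem_Icc_of_tendsto {t : ℝ} (ht₀ : 0 < t)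
    (hbdd : ∀ n, ∀ w ∈ Ioi (0 : ℝ) ×ˢ X n, |u n w| ≤ C) {tn : ℕ → ℝ} {xn : ℕ → Y}
    (hxn : ∀ n, xn n ∈ X n) (ht : Tendsto tn atTop (𝓝 t)) :
    liminf (fun n => u n (tn n, xn n)) atTop ∈ Icc (-C) C := by
  obtain ⟨h₁, h₂⟩ := eventually_abs_le_of_tendsto ht₀ hbdd hxn ht
  exact ⟨le_liminf_of_le (isCoboundedUnder_ge_of_eventually_le _ h₂) h₁,
    liminf_le_of_frequently_le h₂.frequently (isBoundedUnder_of_eventually_ge h₁)⟩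

end Bounded

/-- The standing hypotheses on the spaces and Hamiltonians in the stability theorem. -/
structure IsStabilitySetup {Y : Type*} [MetricSpace Y] (X : ℕ → Set Y) (Xi : Set Y)
    (d : ℕ → Y → Y → ℝ) (di : Y → Y → ℝ)
    (H : ℕ → ℝ → Y → ℝ → ℝ → ℝ) (Hi : ℝ → Y → ℝ → ℝ → ℝ) : Prop where
  nonempty : ∀ n, (X n).Nonempty
  isCompact : ∀ n, IsCompact (X n)
  nonempty_lim : Xi.Nonempty
  isCompact_lim : IsCompact Xi
  isMetricOn : ∀ n, IsMetricOn (X n) (d n)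
  isGeodesic : ∀ n, IsGeodesicWrt (X n) (d n)
  isMetricOn_lim : IsMetricOn Xi di
  isGeodesic_lim : IsGeodesicWrt Xi di
  continuousOn_lim : ContinuousOn (fun q : (ℝ × Y) × ℝ × ℝ => Hi q.1.1 q.1.2 q.2.1 q.2.2)
    ((Ioi (0 : ℝ) ×ˢ Xi) ×ˢ (univ : Set ℝ) ×ˢ Ici (0 : ℝ))
  tendsto_hausdorffDist : Tendsto (fun n => hausdorffDist (X n) Xi) atTop (𝓝 0)
  tendsto_metric : ∀ a ∈ Xi, ∀ b ∈ Xi, ∀ an bn : ℕ → Y, (∀ n, an n ∈ X n) →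
    (∀ n, bn n ∈ X n) → Tendsto an atTop (𝓝 a) → Tendsto bn atTop (𝓝 b) →
    Tendsto (fun n => d n (an n) (bn n)) atTop (𝓝 (di a b))
  tendsto_hamiltonian : ∀ t ∈ Ioi (0 : ℝ), ∀ x ∈ Xi, ∀ tn : ℕ → ℝ, (∀ n, tn n ∈ Ioi (0 : ℝ)) →
    Tendsto tn atTop (𝓝 t) →
    ∀ xn : ℕ → Y, (∀ n, xn n ∈ X n) → Tendsto xn atTop (𝓝 x) →
    ∀ r p : ℝ, 0 ≤ p → ∀ rn pn : ℕ → ℝ, (∀ n, 0 ≤ pn n) →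
    Tendsto rn atTop (𝓝 r) → Tendsto pn atTop (𝓝 p) →
    Tendsto (fun n => H n (tn n) (xn n) (rn n) (pn n)) atTop (𝓝 (Hi t x r p))

namespace IsStabilitySetup

variable {Y : Type*} [MetricSpace Y] {X : ℕ → Set Y} {Xi : Set Y}
  {d : ℕ → Y → Y → ℝ} {di : Y → Y → ℝ}
  {H : ℕ → ℝ → Y → ℝ → ℝ → ℝ} {Hi : ℝ → Y → ℝ → ℝ → ℝ} {u : ℕ → ℝ × Y → ℝ} {C : ℝ}

theorem exists_tendsto (S : IsStabilitySetup X Xi d di H Hi) {x : Y} (hx : x ∈ Xi) :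
    ∃ a : ℕ → Y, (∀ n, a n ∈ X n) ∧ Tendsto a atTop (𝓝 x) := by
  choose a ha hax using fun n => (S.isCompact n).exists_infDist_eq_dist (S.nonempty n) x
  refine ⟨a, ha, tendsto_iff_dist_tendsto_zero.2 ?_⟩
  refine squeeze_zero (fun _ => dist_nonneg) (fun n => ?_) S.tendsto_hausdorffDist
  rw [dist_comm, ← hax n, hausdorffDist_comm]
  exact infDist_le_hausdorffDist_of_mem hx (hausdorffEDist_ne_top_of_nonempty_of_bounded
    S.nonempty_lim (S.nonempty n) S.isCompact_lim.isBounded (S.isCompact n).isBounded)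

theorem exists_subseq_tendsto (S : IsStabilitySetup X Xi d di H Hi) {φ : ℕ → ℕ}
    (hφ : StrictMono φ) {a : ℕ → Y} (ha : ∀ k, a k ∈ X (φ k)) :
    ∃ x ∈ Xi, ∃ σ : ℕ → ℕ, StrictMono σ ∧ Tendsto (a ∘ σ) atTop (𝓝 x) := by
  choose b hb hab using fun k => S.isCompact_lim.exists_infDist_eq_dist S.nonempty_lim (a k)
  obtain ⟨x, hx, σ, hσ, hlim⟩ := S.isCompact_lim.tendsto_subseq hb
  refine ⟨x, hx, σ, hσ, ?_⟩
  have h0 : Tendsto (fun k => hausdorffDist (X (φ (σ k))) Xi) atTop (𝓝 0) :=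
    S.tendsto_hausdorffDist.comp (hφ.comp hσ).tendsto_atTop
  have h1 : Tendsto (fun k => dist (b (σ k)) (a (σ k))) atTop (𝓝 0) := by
    refine squeeze_zero (fun _ => dist_nonneg) (fun k => ?_) h0
    rw [dist_comm, ← hab]
    exact infDist_le_hausdorffDist_of_mem (ha _) (hausdorffEDist_ne_top_of_nonempty_of_bounded
      (S.nonempty _) S.nonempty_lim (S.isCompact _).isBounded S.isCompact_lim.isBounded)
  exact (tendsto_iff_of_dist h1).1 hlim

theorem tendsto_metric_subseq (S : IsStabilitySetup X Xi d di H Hi) {φ : ℕ → ℕ}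
    (hφ : StrictMono φ) {x y : Y} (hx : x ∈ Xi) (hy : y ∈ Xi) {a b : ℕ → Y}
    (ha : ∀ k, a k ∈ X (φ k)) (hb : ∀ k, b k ∈ X (φ k)) (hax : Tendsto a atTop (𝓝 x))
    (hby : Tendsto b atTop (𝓝 y)) :
    Tendsto (fun k => d (φ k) (a k) (b k)) atTop (𝓝 (di x y)) := by
  obtain ⟨a', ha', hax'⟩ := S.exists_tendsto hx
  obtain ⟨b', hb', hby'⟩ := S.exists_tendsto hy
  have := (S.tendsto_metric x hx y hy _ _ (extend_mem hφ ha ha') (extend_mem hφ hb hb')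
    (tendsto_extend hφ hax hax') (tendsto_extend hφ hby hby')).comp hφ.tendsto_atTop
  simpa only [Function.comp_def, hφ.injective.extend_apply] using this

theorem tendsto_hamiltonian_subseq (S : IsStabilitySetup X Xi d di H Hi) {φ : ℕ → ℕ}
    (hφ : StrictMono φ) {t : ℝ} (ht : t ∈ Ioi (0 : ℝ)) {x : Y} (hx : x ∈ Xi) {r p : ℝ}
    (hp : 0 ≤ p) {tn : ℕ → ℝ} {a : ℕ → Y} {rn pn : ℕ → ℝ} (htn : ∀ k, tn k ∈ Ioi (0 : ℝ))
    (ha : ∀ k, a k ∈ X (φ k)) (hpn : ∀ k, pn k ∈ Ici (0 : ℝ)) (htt : Tendsto tn atTop (𝓝 t))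
    (hax : Tendsto a atTop (𝓝 x)) (hr : Tendsto rn atTop (𝓝 r)) (hpp : Tendsto pn atTop (𝓝 p)) :
    Tendsto (fun k => H (φ k) (tn k) (a k) (rn k) (pn k)) atTop (𝓝 (Hi t x r p)) := by
  obtain ⟨a', ha', hax'⟩ := S.exists_tendsto hx
  have := (S.tendsto_hamiltonian t ht x hx _
    (extend_mem (S := fun _ => Ioi (0 : ℝ)) hφ htn fun _ => ht)
    (tendsto_extend hφ htt tendsto_const_nhds) _ (extend_mem hφ ha ha')
    (tendsto_extend hφ hax hax') r p hp _ _
    (extend_mem (S := fun _ => Ici (0 : ℝ)) hφ hpn fun _ => hp)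
    (tendsto_extend hφ hr tendsto_const_nhds)
    (tendsto_extend hφ hpp tendsto_const_nhds)).comp hφ.tendsto_atTop
  simpa only [Function.comp_def, hφ.injective.extend_apply] using this

theorem lowerSemilimit_le_liminf {z : ℝ × Y} (hz : z ∈ Ioi (0 : ℝ) ×ˢ Xi)
    (hbdd : ∀ n, ∀ w ∈ Ioi (0 : ℝ) ×ˢ X n, |u n w| ≤ C) {tn : ℕ → ℝ} {xn : ℕ → Y}
    (hxn : ∀ n, xn n ∈ X n) (ht : Tendsto tn atTop (𝓝 z.1)) (hx : Tendsto xn atTop (𝓝 z.2)) :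
    lowerSemilimit X u z ≤ liminf (fun n => u n (tn n, xn n)) atTop := by
  refine csInf_le ⟨-C, ?_⟩ ⟨tn, xn, hxn, ht, hx, rfl⟩
  rintro _ ⟨tn', xn', hxn', ht', -, rfl⟩
  exact (liminf_mem_Icc_of_tendsto hz.1 hbdd hxn' ht').1

theorem abs_lowerSemilimit_le (S : IsStabilitySetup X Xi d di H Hi)
    (hbdd : ∀ n, ∀ w ∈ Ioi (0 : ℝ) ×ˢ X n, |u n w| ≤ C) :
    ∀ z ∈ Ioi (0 : ℝ) ×ˢ Xi, |lowerSemilimit X u z| ≤ C := by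
  intro z hz
  obtain ⟨a, ha, hax⟩ := S.exists_tendsto hz.2
  have ht : Tendsto (fun _ : ℕ => z.1) atTop (𝓝 z.1) := tendsto_const_nhds
  refine abs_le.2 ⟨le_csInf ⟨_, _, a, ha, ht, hax, rfl⟩ ?_,
    (lowerSemilimit_le_liminf hz hbdd ha ht hax).trans (liminf_mem_Icc_of_tendsto hz.1 hbdd ha ht).2⟩
  rintro _ ⟨tn', xn', hxn', ht', -, rfl⟩
  exact (liminf_mem_Icc_of_tendsto hz.1 hbdd hxn' ht').1

theorem exists_frequently_lt (S : IsStabilitySetup X Xi d di H Hi)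
    (hbdd : ∀ n, ∀ w ∈ Ioi (0 : ℝ) ×ˢ X n, |u n w| ≤ C) {z : ℝ × Y}
    (hz : z ∈ Ioi (0 : ℝ) ×ˢ Xi) {b : ℝ} (hb : lowerSemilimit X u z < b) :
    ∃ tn : ℕ → ℝ, ∃ xn : ℕ → Y, (∀ n, xn n ∈ X n) ∧ Tendsto tn atTop (𝓝 z.1) ∧
      Tendsto xn atTop (𝓝 z.2) ∧ ∃ᶠ n in atTop, u n (tn n, xn n) < b := by
  obtain ⟨a, ha, hax⟩ := S.exists_tendsto hz.2
  obtain ⟨_, ⟨tn, xn, hxn, ht, hx, rfl⟩, hlt⟩ := exists_lt_of_csInf_lt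
    (by exact ⟨_, fun _ => z.1, a, ha, tendsto_const_nhds, hax, rfl⟩) hb
  refine ⟨tn, xn, hxn, ht, hx, frequently_lt_of_liminf_lt ?_ hlt⟩
  exact isCoboundedUnder_ge_of_eventually_le _ (eventually_abs_le_of_tendsto hz.1 hbdd hxn ht).2

theorem lowerSemilimit_le_of_tendsto (S : IsStabilitySetup X Xi d di H Hi)
    (hbdd : ∀ n, ∀ w ∈ Ioi (0 : ℝ) ×ˢ X n, |u n w| ≤ C) {z : ℝ × Y}
    (hz : z ∈ Ioi (0 : ℝ) ×ˢ Xi) {φ : ℕ → ℕ} (hφ : StrictMono φ) {w : ℕ → ℝ × Y}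
    (hw : ∀ k, w k ∈ Ioi (0 : ℝ) ×ˢ X (φ k)) (hwz : Tendsto w atTop (𝓝 z)) {v : ℕ → ℝ} {r : ℝ}
    (hv : ∀ k, u (φ k) (w k) ≤ v k) (hvr : Tendsto v atTop (𝓝 r)) :
    lowerSemilimit X u z ≤ r := by
  obtain ⟨a, ha, hax⟩ := S.exists_tendsto hz.2
  have hz' : Tendsto (fun n => (z.1, a n)) atTop (𝓝 z) :=
    (tendsto_const_nhds (x := z.1)).prodMk_nhds hax
  have hmem := extend_mem (S := fun n => Ioi (0 : ℝ) ×ˢ X n) (b := fun n => (z.1, a n)) hφ hw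
    fun n => ⟨hz.1, ha n⟩
  have hlim := tendsto_extend hφ hwz hz'
  set W := Function.extend φ w fun n => (z.1, a n) with hW
  have ht : Tendsto (fun n => (W n).1) atTop (𝓝 z.1) := (continuous_fst.tendsto z).comp hlim
  have hx : Tendsto (fun n => (W n).2) atTop (𝓝 z.2) := (continuous_snd.tendsto z).comp hlim
  have hxn : ∀ n, (W n).2 ∈ X n := fun n => (hmem n).2
  refine (lowerSemilimit_le_liminf hz hbdd hxn ht hx).trans (le_of_forall_pos_le_add fun ε hε => ?_)
  refine liminf_le_of_frequently_le ?_
    (isBoundedUnder_of_eventually_ge (eventually_abs_le_of_tendsto hz.1 hbdd hxn ht).1)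
  refine hφ.tendsto_atTop.frequently (Eventually.frequently ?_)
  filter_upwards [hvr.eventually_lt_const (lt_add_of_pos_right r hε)] with k hk
  have : W (φ k) = w k := hφ.injective.extend_apply _ _ _
  simp only [this]
  exact (hv k).trans hk.le

theorem lowerSemilimit_le_of_tendsto_lscWrt (S : IsStabilitySetup X Xi d di H Hi)
    (hbdd : ∀ n, ∀ w ∈ Ioi (0 : ℝ) ×ˢ X n, |u n w| ≤ C) {z : ℝ × Y}
    (hz : z ∈ Ioi (0 : ℝ) ×ˢ Xi) {φ : ℕ → ℕ} (hφ : StrictMono φ) {w : ℕ → ℝ × Y}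
    (hw : ∀ k, w k ∈ Ioi (0 : ℝ) ×ˢ X (φ k)) (hwz : Tendsto w atTop (𝓝 z)) {r : ℝ}
    (hvr : Tendsto (fun k => lscWrt (Ioi (0 : ℝ) ×ˢ X (φ k)) (u (φ k)) (w k)) atTop (𝓝 r)) :
    lowerSemilimit X u z ≤ r := by
  have h0 := tendsto_one_div_add_atTop_nhds_zero_nat (𝕜 := ℝ)
  have hex : ∀ k : ℕ, ∃ w' ∈ Ioi (0 : ℝ) ×ˢ X (φ k), dist (w k) w' ≤ 1 / ((k : ℝ) + 1) ∧
      u (φ k) w' ≤ lscWrt (Ioi (0 : ℝ) ×ˢ X (φ k)) (u (φ k)) (w k) + 1 / ((k : ℝ) + 1) := by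
    intro k
    have hpos : 0 < 1 / ((k : ℝ) + 1) := by positivity
    have hball : ∀ᶠ y in 𝓝[Ioi (0 : ℝ) ×ˢ X (φ k)] w k, y ∈ ball (w k) (1 / ((k : ℝ) + 1)) :=
      nhdsWithin_le_nhds (ball_mem_nhds _ hpos)
    obtain ⟨w', h₁, h₂, h₃⟩ := ((frequently_lt_of_lscWrt_lt (hbdd (φ k)) (hw k)
      (lt_add_of_pos_right _ hpos)).and_eventually (hball.and self_mem_nhdsWithin)).exists
    exact ⟨w', h₃, (mem_ball'.1 h₂).le, h₁.le⟩
  choose w' hw' hd hle using hex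
  refine S.lowerSemilimit_le_of_tendsto hbdd hz hφ hw' ?_ hle (by simpa using hvr.add h0)
  exact (tendsto_iff_of_dist (squeeze_zero (fun _ => dist_nonneg) hd h0)).1 hwz

theorem tendsto_barrier (S : IsStabilitySetup X Xi d di H Hi) {φ : ℕ → ℕ}
    (hφ : StrictMono φ) {x y x₀ : Y} (hx : x ∈ Xi) (hy : y ∈ Xi) (hx₀ : x₀ ∈ Xi)
    {a b c : ℕ → Y} (ha : ∀ k, a k ∈ X (φ k)) (hb : ∀ k, b k ∈ X (φ k))
    (hc : ∀ k, c k ∈ X (φ k)) (hax : Tendsto a atTop (𝓝 x)) (hby : Tendsto b atTop (𝓝 y))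
    (hcx : Tendsto c atTop (𝓝 x₀)) {t : ℝ} {tn : ℕ → ℝ} (ht : Tendsto tn atTop (𝓝 t))
    (κ A m B t₀ : ℝ) :
    Tendsto (fun k => quadBarrier (d (φ k)) κ (b k) (tn k, a k) +
        coneBarrier (d (φ k)) A m B t₀ (c k) (tn k, a k)) atTop
      (𝓝 (quadBarrier di κ y (t, x) + coneBarrier di A m B t₀ x₀ (t, x))) := by
  have h₁ := S.tendsto_metric_subseq hφ hx hy ha hb hax hby
  have h₂ := S.tendsto_metric_subseq hφ hx hx₀ ha hc hax hcx
  exact ((h₁.pow 2).const_mul κ).neg.add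
    (((h₂.const_mul A).neg.add (ht.const_mul m)).sub (((ht.sub_const t₀).pow 2).const_mul B))

end IsStabilitySetup

section LimitPoint

variable {Y : Type*} [MetricSpace Y] {X : ℕ → Set Y} {Xi : Set Y}
  {d : ℕ → Y → Y → ℝ} {di : Y → Y → ℝ}
  {H : ℕ → ℝ → Y → ℝ → ℝ → ℝ} {Hi : ℝ → Y → ℝ → ℝ → ℝ} {u : ℕ → ℝ × Y → ℝ} {C : ℝ}

/-- Minimum of the lower envelope minus a barrier over a cylinder. -/
theorem exists_isMinOn_cylinder {s : Set Y} {ρ : Y → Y → ℝ} (hc : IsCompact s)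
    (hm : IsMetricOn s ρ) {v : ℝ × Y → ℝ} (hv : ∀ w ∈ Ioi (0 : ℝ) ×ˢ s, |v w| ≤ C)
    {κ A m B t₀ r R : ℝ} (hκ : 0 ≤ κ) (hA : 0 ≤ A) {y x₀ : Y} (hy : y ∈ s) (hx₀ : x₀ ∈ s)
    (hr : 0 < r) (hrt : r < t₀) (hR : 0 < R) :
    ∃ w : ℝ × Y, |w.1 - t₀| ≤ r ∧ w.2 ∈ s ∧ ρ w.2 x₀ ≤ R ∧
      ∀ w' : ℝ × Y, |w'.1 - t₀| ≤ r → w'.2 ∈ s → ρ w'.2 x₀ ≤ R →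
        lscWrt (Ioi (0 : ℝ) ×ˢ s) v w - (quadBarrier ρ κ y w + coneBarrier ρ A m B t₀ x₀ w) ≤
        lscWrt (Ioi (0 : ℝ) ×ˢ s) v w' -
          (quadBarrier ρ κ y w' + coneBarrier ρ A m B t₀ x₀ w') := by
  have hK : IsCompact (s ∩ (fun x => ρ x x₀) ⁻¹' Iic R) :=
    hc.of_isClosed_subset ((hm.continuousOn_left hx₀).preimage_isClosed_of_isClosed
      hc.isClosed isClosed_Iic) inter_subset_left
  have hKc : IsCompact (Icc (t₀ - r) (t₀ + r) ×ˢ (s ∩ (fun x => ρ x x₀) ⁻¹' Iic R)) :=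
    isCompact_Icc.prod hK
  have hsub : Icc (t₀ - r) (t₀ + r) ×ˢ (s ∩ (fun x => ρ x x₀) ⁻¹' Iic R) ⊆
      Ioi (0 : ℝ) ×ˢ s := fun w hw => ⟨lt_of_lt_of_le (by linarith) hw.1.1, hw.2.1⟩
  have hne : (Icc (t₀ - r) (t₀ + r) ×ˢ (s ∩ (fun x => ρ x x₀) ⁻¹' Iic R)).Nonempty :=
    ⟨(t₀, x₀), ⟨by linarith, by linarith⟩, hx₀, by simpa [hm.refl x₀ hx₀] using hR.le⟩
  have hT : ContinuousOn (fun w => -(quadBarrier ρ κ y w + coneBarrier ρ A m B t₀ x₀ w))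
      (Ioi (0 : ℝ) ×ˢ s) :=
    (((locLipWrt_quadBarrier hm hκ hy).continuousOn_prodMet hm).add
      ((locLipWrt_coneBarrier hm hA m B t₀ hx₀).continuousOn_prodMet hm)).neg
  have hlsc := ((lowerSemicontinuousOn_lscWrt hv).add hT.lowerSemicontinuousOn).mono hsub
  obtain ⟨w, hw, hmin⟩ := hlsc.exists_isMinOn hne hKc
  have habs : ∀ τ : ℝ, τ ∈ Icc (t₀ - r) (t₀ + r) ↔ |τ - t₀| ≤ r := by
    intro τ
    rw [abs_le, mem_Icc]
    constructor <;> rintro ⟨h₁, h₂⟩ <;> constructor <;> linarith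
  refine ⟨w, (habs _).1 hw.1, hw.2.1, hw.2.2, fun w' h₁ h₂ h₃ => ?_⟩
  have h := hmin (show w' ∈ _ from ⟨(habs _).2 h₁, h₂, h₃⟩)
  simp only [mem_ofPred_eq, ← sub_eq_add_neg] at h
  exact h

/-- If the lower envelope of the lower semilimit minus a barrier can only be nearly minimal in the
interior of a cylinder, then minimum points of the approximating problems accumulate at a point of
the cylinder where the limit inequality holds. -/
theorem IsStabilitySetup.exists_limit_point (S : IsStabilitySetup X Xi d di H Hi)
    (hsup : ∀ n, IsMVSupersolutionTWrt (X n) (d n) (H n) (u n))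
    (hbdd : ∀ n, ∀ w ∈ Ioi (0 : ℝ) ×ˢ X n, |u n w| ≤ C) {z : ℝ × Y}
    (hz : z ∈ Ioi (0 : ℝ) ×ˢ Xi) {κ A m B r R η : ℝ} (hκ : 0 ≤ κ) (hA : 0 ≤ A) {y : Y}
    (hy : y ∈ Xi) (hr : 0 < r) (hrt : r < z.1) (hR : 0 < R) (hη : 0 < η)
    (U : ℝ × Y → ℝ) (hU : U = lscWrt (Ioi (0 : ℝ) ×ˢ Xi) (lowerSemilimit X u))
    (T : ℝ × Y → ℝ) (hT : T = fun w => quadBarrier di κ y w + coneBarrier di A m B z.1 z.2 w)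
    (hint : ∀ t x, |t - z.1| ≤ r → x ∈ Xi → di x z.2 ≤ R → U (t, x) - T (t, x) ≤ U z - T z + η →
      |t - z.1| < r ∧ di x z.2 < R) :
    ∃ t x v q, |t - z.1| < r ∧ x ∈ Xi ∧ di x z.2 < R ∧ U (t, x) ≤ v ∧
      v - T (t, x) ≤ U z - T z + η ∧ 0 ≤ q ∧ |q - 2 * κ * di x y| ≤ A ∧
      0 ≤ m - 2 * B * (t - z.1) + η + Hi t x v q := by
  have hmi := S.isMetricOn_lim
  have hlb := S.abs_lowerSemilimit_le hbdd
  obtain ⟨xh, hxh, hxlim⟩ := S.exists_tendsto hz.2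
  obtain ⟨yh, hyh, hylim⟩ := S.exists_tendsto hy
  choose w hwt hwX hwR hwmin using fun n => exists_isMinOn_cylinder (v := u n) (C := C) (m := m)
    (B := B) (S.isCompact n) (S.isMetricOn n) (hbdd n) hκ hA (hyh n) (hxh n) hr hrt hR
  have hpos : ∀ t : ℝ, |t - z.1| ≤ r → t ∈ Ioi (0 : ℝ) := fun t ht => by
    have := (abs_le.1 ht).1
    simp only [mem_Ioi]
    linarith
  have hwS : ∀ n, w n ∈ Ioi (0 : ℝ) ×ˢ X n := fun n => ⟨hpos _ (hwt n), hwX n⟩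
  set V : ℕ → ℝ × Y → ℝ := fun n => lscWrt (Ioi (0 : ℝ) ×ˢ X n) (u n) with hV
  set Tn : ℕ → ℝ × Y → ℝ := fun n w =>
    quadBarrier (d n) κ (yh n) w + coneBarrier (d n) A m B z.1 (xh n) w with hTn
  -- the minimal values are frequently almost below the value at `z`
  have hfreq : ∃ᶠ n in atTop, V n (w n) - Tn n (w n) < U z - T z + η := by
    have hTc : ContinuousOn T (Ioi (0 : ℝ) ×ˢ Xi) := by
      rw [hT]
      exact ((locLipWrt_quadBarrier hmi hκ hy).continuousOn_prodMet hmi).add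
        ((locLipWrt_coneBarrier hmi hA m B z.1 hz.2).continuousOn_prodMet hmi)
    have hsnd : ContinuousOn (fun w : ℝ × Y => di w.2 z.2) (Ioi (0 : ℝ) ×ˢ Xi) :=
      (hmi.continuousOn_left hz.2).comp continuousOn_snd fun w hw => hw.2
    have e₁ : ∀ᶠ w in 𝓝[Ioi (0 : ℝ) ×ˢ Xi] z, T z - η / 3 < T w :=
      (hTc z hz).eventually_const_lt (by linarith)
    have e₂ : ∀ᶠ w in 𝓝[Ioi (0 : ℝ) ×ˢ Xi] z, di w.2 z.2 < R :=
      (hsnd z hz).eventually_lt_const (by simpa [hmi.refl z.2 hz.2] using hR)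
    have e₃ : ∀ᶠ w in 𝓝[Ioi (0 : ℝ) ×ˢ Xi] z, |w.1 - z.1| < r := by
      have : ContinuousAt (fun w : ℝ × Y => |w.1 - z.1|) z := by fun_prop
      exact nhdsWithin_le_nhds (this.eventually_lt_const (by simpa using hr))
    have e₀ : ∃ᶠ w in 𝓝[Ioi (0 : ℝ) ×ˢ Xi] z, lowerSemilimit X u w < U z + η / 3 :=
      frequently_lt_of_lscWrt_lt hlb hz (by rw [← hU]; linarith)
    obtain ⟨z', h₀, h₁, h₂, h₃, h₄⟩ := (e₀.and_eventually
      (e₁.and (e₂.and (e₃.and self_mem_nhdsWithin)))).exists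
    obtain ⟨tn, xn, hxn, htlim, hxnlim, hlt⟩ := S.exists_frequently_lt hbdd h₄ h₀
    have hTlim := S.tendsto_barrier strictMono_id h₄.2 hy hz.2 hxn hyh hxh hxnlim hylim hxlim
      htlim κ A m B z.1
    have hdlim := S.tendsto_metric_subseq strictMono_id h₄.2 hz.2 hxn hxh hxnlim hxlim
    have htl : Tendsto (fun n => |tn n - z.1|) atTop (𝓝 |z'.1 - z.1|) :=
      (htlim.sub_const _).abs
    have hTz' : T z - η / 3 < quadBarrier di κ y (z'.1, z'.2) +
        coneBarrier di A m B z.1 z.2 (z'.1, z'.2) := by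
      simpa only [hT] using h₁
    refine (hlt.and_eventually ((hTlim.eventually_const_lt hTz').and
      ((hdlim.eventually_lt_const h₂).and (htl.eventually_lt_const h₃)))).mono ?_
    rintro n ⟨k₀, k₁, k₂, k₃⟩
    have hmem : (tn n, xn n) ∈ Ioi (0 : ℝ) ×ˢ X n := ⟨hpos _ k₃.le, hxn n⟩
    have k₄ := hwmin n (tn n, xn n) k₃.le (hxn n) k₂.le
    have k₅ : V n (tn n, xn n) ≤ u n (tn n, xn n) := lscWrt_le (hbdd n) hmem
    simp only [id_eq] at k₁
    simp only [hV, hTn] at k₄ k₅ ⊢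
    linarith
  obtain ⟨φ₀, hφ₀, hlow⟩ := extraction_of_frequently_atTop hfreq
  obtain ⟨x, hx, σ₁, hσ₁, hxσ⟩ := S.exists_subseq_tendsto hφ₀ fun k => hwX (φ₀ k)
  have hcomp : ∀ k, ((w (φ₀ (σ₁ k))).1, V (φ₀ (σ₁ k)) (w (φ₀ (σ₁ k)))) ∈
      Icc (z.1 - r) (z.1 + r) ×ˢ Icc (-C) C := by
    intro k
    have h₁ := abs_le.1 (hwt (φ₀ (σ₁ k)))
    exact ⟨⟨by linarith, by linarith⟩, abs_le.1 (abs_lscWrt_le (hbdd _) (hwS _))⟩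
  obtain ⟨⟨t, v⟩, -, σ₂, hσ₂, htv⟩ := (isCompact_Icc.prod isCompact_Icc).tendsto_subseq hcomp
  set φ : ℕ → ℕ := fun k => φ₀ (σ₁ (σ₂ k)) with hφdef
  have hφ : StrictMono φ := hφ₀.comp (hσ₁.comp hσ₂)
  have htlim : Tendsto (fun k => (w (φ k)).1) atTop (𝓝 t) :=
    (continuous_fst.tendsto (t, v)).comp htv
  have hvlim : Tendsto (fun k => V (φ k) (w (φ k))) atTop (𝓝 v) :=
    (continuous_snd.tendsto (t, v)).comp htv
  have hxlim' : Tendsto (fun k => (w (φ k)).2) atTop (𝓝 x) := hxσ.comp hσ₂.tendsto_atTop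
  have hxhφ := hxlim.comp hφ.tendsto_atTop
  have hyhφ := hylim.comp hφ.tendsto_atTop
  have hdx := S.tendsto_metric_subseq hφ hx hz.2 (fun k => hwX (φ k)) (fun k => hxh (φ k))
    hxlim' hxhφ
  have hdy := S.tendsto_metric_subseq hφ hx hy (fun k => hwX (φ k)) (fun k => hyh (φ k))
    hxlim' hyhφ
  have hTlim := S.tendsto_barrier hφ hx hy hz.2 (fun k => hwX (φ k)) (fun k => hyh (φ k))
    (fun k => hxh (φ k)) hxlim' hyhφ hxhφ htlim κ A m B z.1
  have htabs : Tendsto (fun k => |(w (φ k)).1 - z.1|) atTop (𝓝 |t - z.1|) :=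
    (htlim.sub_const _).abs
  have ht : |t - z.1| ≤ r := le_of_tendsto' htabs fun k => hwt _
  have hxR : di x z.2 ≤ R := le_of_tendsto' hdx fun k => hwR _
  have hmem : (t, x) ∈ Ioi (0 : ℝ) ×ˢ Xi := ⟨hpos t ht, hx⟩
  have hUv : U (t, x) ≤ v := by
    rw [hU]
    exact (lscWrt_le hlb hmem).trans (S.lowerSemilimit_le_of_tendsto_lscWrt hbdd hmem hφ
      (fun k => hwS (φ k)) (htlim.prodMk_nhds hxlim') hvlim)
  have hvT : v - T (t, x) ≤ U z - T z + η := by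
    rw [show T (t, x) = quadBarrier di κ y (t, x) + coneBarrier di A m B z.1 z.2 (t, x) by rw [hT]]
    exact le_of_tendsto' (hvlim.sub hTlim) fun k => (hlow (σ₁ (σ₂ k))).le
  obtain ⟨ht', hxR'⟩ := hint t x ht hx hxR (by linarith)
  have hev : ∀ᶠ k in atTop, ∃ q, 0 ≤ q ∧ |q - 2 * κ * d (φ k) (w (φ k)).2 (yh (φ k))| ≤ A ∧
      -η < m - 2 * B * ((w (φ k)).1 - z.1) +
        H (φ k) (w (φ k)).1 (w (φ k)).2 (V (φ k) (w (φ k))) q := by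
    filter_upwards [htabs.eventually_lt_const ht', hdx.eventually_lt_const hxR'] with k h₁ h₂
    refine (hsup (φ k)).exists_of_isLocalMinOn (S.isMetricOn _) (S.isGeodesic _) hκ hA
      (hyh (φ k)) (hxh (φ k)) (hwS (φ k)) ?_ hη
    have hsnd : ContinuousOn (fun p : ℝ × Y => d (φ k) p.2 (xh (φ k)))
        (Ioi (0 : ℝ) ×ˢ X (φ k)) :=
      ((S.isMetricOn _).continuousOn_left (hxh (φ k))).comp continuousOn_snd fun p hp => hp.2
    have e₂ : ∀ᶠ p in 𝓝[Ioi (0 : ℝ) ×ˢ X (φ k)] w (φ k), d (φ k) p.2 (xh (φ k)) < R :=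
      (hsnd _ (hwS _)).eventually_lt_const h₂
    have e₁ : ∀ᶠ p in 𝓝[Ioi (0 : ℝ) ×ˢ X (φ k)] w (φ k), |p.1 - z.1| < r := by
      have : ContinuousAt (fun p : ℝ × Y => |p.1 - z.1|) (w (φ k)) := by fun_prop
      exact nhdsWithin_le_nhds (this.eventually_lt_const h₁)
    filter_upwards [e₁, e₂, self_mem_nhdsWithin] with p p₁ p₂ p₃
    exact hwmin (φ k) p p₁.le p₃.2 p₂.le
  have hdy' : ∀ᶠ k in atTop, d (φ k) (w (φ k)).2 (yh (φ k)) < di x y + 1 :=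
    hdy.eventually_lt_const (lt_add_one _)
  obtain ⟨N, hN⟩ := eventually_atTop.1 (hev.and hdy')
  choose q hq₀ hqA hqH using fun k => (hN (k + N) (Nat.le_add_left _ _)).1
  have hqmem : ∀ k, q k ∈ Icc 0 (2 * κ * (di x y + 1) + A) := by
    intro k
    have h₁ := (abs_le.1 (hqA k)).2
    have h₂ := mul_le_mul_of_nonneg_left (hN (k + N) (Nat.le_add_left _ _)).2.le
      (by positivity : 0 ≤ 2 * κ)
    exact ⟨hq₀ k, by linarith⟩
  obtain ⟨qs, hqs, σ₃, hσ₃, hqlim⟩ := isCompact_Icc.tendsto_subseq hqmem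
  have hshift : StrictMono fun k => σ₃ k + N := fun a b hab => Nat.add_lt_add_right (hσ₃ hab) N
  have hτ := hshift.tendsto_atTop
  refine ⟨t, x, v, qs, ht', hx, hxR', hUv, hvT, hqs.1, ?_, ?_⟩
  · exact le_of_tendsto' ((hqlim.sub ((hdy.comp hτ).const_mul (2 * κ))).abs) fun k => hqA (σ₃ k)
  · have hHlim := S.tendsto_hamiltonian_subseq (hφ.comp hshift) hmem.1 hx hqs.1
      (fun k => (hwS _).1) (fun k => hwX _) (fun k => hq₀ (σ₃ k)) (htlim.comp hτ)
      (hxlim'.comp hτ) (hvlim.comp hτ) hqlim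
    have hlim := ((((htlim.comp hτ).sub_const z.1).const_mul (2 * B)).const_sub m).add hHlim
    have := ge_of_tendsto' hlim fun k => (hqH (σ₃ k)).le
    linarith

end LimitPoint

section TestFunction

variable {Y : Type*} [MetricSpace Y] {s : Set Y} {ρ : Y → Y → ℝ} {ψ : ℝ × Y → ℝ}

/-- A function which is `C^{1,+}` in space is touched from below, up to a small error and at
arbitrarily small scales, by a multiple of a squared distance. -/
theorem LocLipWrt.exists_quadBarrier_le (hm : IsMetricOn s ρ) (hg : IsGeodesicWrt s ρ)
    (hψ : LocLipWrt (Ioi (0 : ℝ) ×ˢ s) (prodMet ρ) ψ) {z : ℝ × Y} (hz : z ∈ Ioi (0 : ℝ) ×ˢ s)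
    (hc : ContinuousWithinAt (slopeSpWrt s ρ ψ) (Ioi (0 : ℝ) ×ˢ s) z)
    (hup : upperSlopeSpWrt s ρ ψ z = slopeSpWrt s ρ ψ z) {ε r₀ : ℝ} (hε : 0 < ε) (hr₀ : 0 < r₀) :
    ∃ r > 0, r < r₀ ∧ ∃ κ ≥ 0, ∃ y ∈ s,
      (∀ x ∈ s, ρ x z.2 ≤ r → quadBarrier ρ κ y (z.1, x) - quadBarrier ρ κ y z - 2 * ε * r ≤
        ψ (z.1, x) - ψ z) ∧
      ∀ δ ≤ 1, ∀ x ∈ s, ρ x z.2 ≤ δ * r →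
        |2 * κ * ρ x y - slopeSpWrt s ρ ψ z| ≤ ε + (slopeSpWrt s ρ ψ z + ε) * δ := by
  set p := slopeSpWrt s ρ ψ z with hp
  have hp0 : 0 ≤ p := hψ.slopeSpWrt_nonneg hm hz
  obtain ⟨R, hR, hbox⟩ := hm.exists_box hz
    (hc.eventually_lt_const (show slopeSpWrt s ρ ψ z < p + ε by linarith))
  have hbox' := (hbox z.1 (by simpa using hR)).2
  have hlip : ∀ r, r < R / 4 → ∀ x ∈ s, ρ x z.2 ≤ r → ∀ y ∈ s, ρ z.2 y ≤ r →
      ψ (z.1, y) - ψ (z.1, x) ≤ (p + ε) * ρ x y := by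
    intro r hr x hx hxr y hy hyr
    refine hψ.sub_le_of_slopeSpWrt_lt hm hg hz.1 hx hy fun w hw hwx => hbox' w hw ?_
    have h₁ := hm.triangle x hx z.2 hz.2 y hy
    have h₂ := hm.triangle z.2 hz.2 x hx w hw
    rw [hm.symm z.2 hz.2 x hx] at h₂
    linarith
  rcases le_or_gt p ε with hpε | hpε
  · have hr₁ : 0 < min r₀ (R / 4) := lt_min hr₀ (by linarith)
    refine ⟨min r₀ (R / 4) / 2, by linarith, by linarith [min_le_left r₀ (R / 4)], 0, le_rfl, z.2,
      hz.2, fun x hx hxr => ?_, fun δ _ x hx hxr => ?_⟩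
    · have h := hlip (min r₀ (R / 4) / 2) (by linarith [min_le_right r₀ (R / 4)]) x hx hxr z.2 hz.2
        (by rw [hm.refl z.2 hz.2]; linarith)
      have h' : (p + ε) * ρ x z.2 ≤ 2 * ε * (min r₀ (R / 4) / 2) :=
        mul_le_mul (by linarith) hxr (hm.nonneg hx hz.2) (by linarith)
      simp only [quadBarrier]
      have e : ψ (z.1, z.2) = ψ z := rfl
      linarith
    · have hδ : 0 ≤ δ := by
        by_contra! hδ
        have := mul_neg_of_neg_of_pos hδ (half_pos hr₁)
        linarith [hm.nonneg hx hz.2]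
      have : 0 ≤ (p + ε) * δ := by positivity
      rw [mul_zero, zero_mul, zero_sub, abs_neg, abs_of_nonneg hp0]
      linarith
  · have hfreq : ∃ᶠ y in 𝓝[s \ {z.2}] z.2, p - ε < max (ψ (z.1, y) - ψ z) 0 / ρ z.2 y := by
      intro hcon
      have h := (limsup_mem_Icc_of_eventually (show 0 ≤ p - ε by linarith)
        (eventually_quotient_nonneg hm (fun y => max (ψ (z.1, y) - ψ z) 0)
          (fun _ => le_max_right _ _) hz.2) (hcon.mono fun _ h => not_lt.1 h)).2
      change upperSlopeSpWrt s ρ ψ z ≤ p - ε at h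
      linarith
    have hsmall : ∀ᶠ y in 𝓝[s \ {z.2}] z.2, ρ z.2 y < min r₀ (R / 4) :=
      (hm.eventually_lt hz.2 (lt_min hr₀ (by linarith))).filter_mono
        (nhdsWithin_mono _ sdiff_subset)
    obtain ⟨y, hy₁, hy₂, hys⟩ := (hfreq.and_eventually
      (hsmall.and self_mem_nhdsWithin)).exists
    set r := ρ z.2 y with hr
    have hr0 : 0 < r := hm.pos hz.2 hys.1 fun e => hys.2 e.symm
    have hψy : (p - ε) * r < ψ (z.1, y) - ψ z := by
      have h := (lt_div_iff₀ hr0).1 hy₁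
      exact (lt_max_iff.1 h).resolve_right (not_lt.2 (mul_nonneg (by linarith) hr0.le))
    refine ⟨r, hr0, hy₂.trans_le (min_le_left _ _), (p + ε) / (2 * r), by positivity, y, hys.1,
      fun x hx hxr => ?_, fun δ _ x hx hxr => ?_⟩
    · have h := hlip r (hy₂.trans_le (min_le_right _ _)) x hx hxr y hys.1 le_rfl
      have h₁ : (p + ε) * ρ x y ≤ (p + ε) / (2 * r) * ρ x y ^ 2 + (p + ε) / (2 * r) * r ^ 2 := by
        have h₂ : 0 ≤ (p + ε) / (2 * r) * (ρ x y - r) ^ 2 := by positivity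
        have h₃ : (p + ε) / (2 * r) * (2 * r * ρ x y) = (p + ε) * ρ x y := by field_simp
        linarith
      have h₂ : (p + ε) / (2 * r) * r ^ 2 = (p + ε) * r / 2 := by field_simp
      simp only [quadBarrier, ← hr]
      linarith
    · have h₁ := hm.abs_sub_le hx hz.2 hys.1
      rw [← hr] at h₁
      have e : 2 * ((p + ε) / (2 * r)) * ρ x y - p = ε + (p + ε) * ((ρ x y - r) / r) := by
        field_simp
        ring
      have h₂ : |(ρ x y - r) / r| ≤ δ := by
        rw [abs_div, abs_of_pos hr0, div_le_iff₀ hr0]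
        exact h₁.trans hxr
      rw [e]
      refine (abs_add_le _ _).trans ?_
      rw [abs_of_pos hε, abs_mul, abs_of_nonneg (by linarith : 0 ≤ p + ε)]
      gcongr

/-- Mean value inequality around an affine function. -/
theorem abs_sub_sub_mul_le_of_hasDerivAt {f f' : ℝ → ℝ} {a b m ε : ℝ}
    (hf : ∀ τ ∈ uIcc a b, HasDerivAt f (f' τ) τ) (hb : ∀ τ ∈ uIcc a b, |f' τ - m| ≤ ε) :
    |f b - f a - m * (b - a)| ≤ ε * |b - a| := by
  have h := Convex.norm_image_sub_le_of_norm_hasDerivWithin_le (f := fun τ => f τ - m * τ)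
    (f' := fun τ => f' τ - m) (s := uIcc a b) (C := ε) (x := a) (y := b)
    (fun τ hτ => by
      have h := ((hf τ hτ).sub ((hasDerivAt_id τ).const_mul m)).hasDerivWithinAt (s := uIcc a b)
      rw [mul_one] at h
      exact h)
    hb (convex_uIcc a b) left_mem_uIcc right_mem_uIcc
  rw [Real.norm_eq_abs, Real.norm_eq_abs] at h
  convert h using 2
  ring

end TestFunction

section Stability

variable {Y : Type*} [MetricSpace Y] {X : ℕ → Set Y} {Xi : Set Y}
  {d : ℕ → Y → Y → ℝ} {di : Y → Y → ℝ}
  {H : ℕ → ℝ → Y → ℝ → ℝ → ℝ} {Hi : ℝ → Y → ℝ → ℝ → ℝ} {u : ℕ → ℝ × Y → ℝ} {C : ℝ}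

/-- Approximate supersolution inequality near a point where a test function touches the lower
envelope of the lower semilimit from below. -/
theorem IsStabilitySetup.exists_approx (S : IsStabilitySetup X Xi d di H Hi)
    (hsup : ∀ n, IsMVSupersolutionTWrt (X n) (d n) (H n) (u n))
    (hbdd : ∀ n, ∀ w ∈ Ioi (0 : ℝ) ×ˢ X n, |u n w| ≤ C) {ψ₁ ψ₂ dψ₁ dψ₂ : ℝ × Y → ℝ}
    (hψ₁ : LocLipWrt (Ioi (0 : ℝ) ×ˢ Xi) (prodMet di) ψ₁)
    (hψ₂ : LocLipWrt (Ioi (0 : ℝ) ×ˢ Xi) (prodMet di) ψ₂)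
    (hd₁ : ∀ z ∈ Ioi (0 : ℝ) ×ˢ Xi, HasDerivAt (fun τ => ψ₁ (τ, z.2)) (dψ₁ z) z.1)
    (hdc₁ : ContinuousOn dψ₁ (Ioi (0 : ℝ) ×ˢ Xi))
    (hd₂ : ∀ z ∈ Ioi (0 : ℝ) ×ˢ Xi, HasDerivAt (fun τ => ψ₂ (τ, z.2)) (dψ₂ z) z.1)
    (hdc₂ : ContinuousOn dψ₂ (Ioi (0 : ℝ) ×ˢ Xi))
    (hc : ContinuousOn (slopeSpWrt Xi di ψ₁) (Ioi (0 : ℝ) ×ˢ Xi))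
    (hup : ∀ z ∈ Ioi (0 : ℝ) ×ˢ Xi, upperSlopeSpWrt Xi di ψ₁ z = slopeSpWrt Xi di ψ₁ z)
    (U : ℝ × Y → ℝ) (hU : U = lscWrt (Ioi (0 : ℝ) ×ˢ Xi) (lowerSemilimit X u)) {z : ℝ × Y}
    (hz : z ∈ Ioi (0 : ℝ) ×ˢ Xi)
    (hmin : IsLocalMinOn (fun w => U w - (ψ₁ w + ψ₂ w)) (Ioi (0 : ℝ) ×ˢ Xi) z)
    {θ : ℝ} (hθ : 0 < θ) :
    ∃ t x v q, 0 < t ∧ x ∈ Xi ∧ |t - z.1| < θ ∧ di x z.2 < θ ∧ |v - U z| < θ ∧ 0 ≤ q ∧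
      |q - slopeSpWrt Xi di ψ₁ z| ≤
        uscWrt (Ioi (0 : ℝ) ×ˢ Xi) (slopeSpWrt Xi di ψ₂) z + θ ∧
      0 ≤ dψ₁ z + dψ₂ z + θ + Hi t x v q := by
  have hm := S.isMetricOn_lim
  have hg := S.isGeodesic_lim
  set p := slopeSpWrt Xi di ψ₁ z
  have hp : 0 ≤ p := hψ₁.slopeSpWrt_nonneg hm hz
  set a := uscWrt (Ioi (0 : ℝ) ×ˢ Xi) (slopeSpWrt Xi di ψ₂) z with ha
  have ha0 : 0 ≤ a := hψ₂.uscWrt_slopeSpWrt_nonneg hm hz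
  set m := dψ₁ z + dψ₂ z with hmdef
  obtain ⟨δ, hδ0, hδ1, hδθ⟩ : ∃ δ > 0, δ ≤ 1 ∧ δ * (p + 22) ≤ θ := by
    refine ⟨min 1 (θ / (p + 22)), lt_min one_pos (by positivity), min_le_left _ _, ?_⟩
    exact (le_div_iff₀ (by positivity)).1 (min_le_right _ _)
  have hpδ : 0 ≤ p * δ := by positivity
  set ε := δ ^ 2 with hεdef
  have hε : 0 < ε := by positivity
  have hεδ : ε ≤ δ := by nlinarith
  have hψc : ContinuousOn (fun w => ψ₁ w + ψ₂ w) (Ioi (0 : ℝ) ×ˢ Xi) :=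
    (hψ₁.continuousOn_prodMet hm).add (hψ₂.continuousOn_prodMet hm)
  have e₁ : ∀ᶠ w in 𝓝[Ioi (0 : ℝ) ×ˢ Xi] z, |dψ₁ w + dψ₂ w - m| < ε := by
    have h : ContinuousWithinAt (fun w => |dψ₁ w + dψ₂ w - m|) (Ioi (0 : ℝ) ×ˢ Xi) z :=
      (((hdc₁ z hz).add (hdc₂ z hz)).sub continuousWithinAt_const).abs
    exact h.eventually_lt_const (by simpa [hmdef] using hε)
  have e₂ : ∀ᶠ w in 𝓝[Ioi (0 : ℝ) ×ˢ Xi] z, |ψ₁ w + ψ₂ w - (ψ₁ z + ψ₂ z)| < θ / 2 := by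
    have h : ContinuousWithinAt (fun w => |ψ₁ w + ψ₂ w - (ψ₁ z + ψ₂ z)|)
      (Ioi (0 : ℝ) ×ˢ Xi) z := ((hψc z hz).sub continuousWithinAt_const).abs
    exact h.eventually_lt_const (by simpa using hθ)
  have e₃ : ∀ᶠ w in 𝓝[Ioi (0 : ℝ) ×ˢ Xi] z, slopeSpWrt Xi di ψ₂ w < a + ε :=
    hψ₂.eventually_slopeSpWrt_lt hm hz (by linarith)
  have e₄ : ∀ᶠ w in 𝓝[Ioi (0 : ℝ) ×ˢ Xi] z,
      U z - (ψ₁ z + ψ₂ z) ≤ U w - (ψ₁ w + ψ₂ w) := hmin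
  obtain ⟨R, hR, hbox⟩ := hm.exists_box hz (e₁.and (e₂.and (e₃.and e₄)))
  obtain ⟨r, hr, hrR, κ, hκ, y, hy, hquad, hslope⟩ := hψ₁.exists_quadBarrier_le hm hg hz (hc z hz)
    (hup z hz) hε (show 0 < min θ (min 1 (R / 4)) by positivity)
  have hrθ : r < θ := hrR.trans_le (min_le_left _ _)
  have hr1 : r < 1 := hrR.trans_le ((min_le_right _ _).trans (min_le_left _ _))
  have hrR' : r < R / 4 := hrR.trans_le ((min_le_right _ _).trans (min_le_right _ _))
  have hrt : r < z.1 := by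
    have := (hbox (z.1 - r) (by rw [sub_sub_cancel_left, abs_neg, abs_of_pos hr]; linarith)).1
    linarith
  have hδr : δ * r ≤ r := by nlinarith
  have hεr : ε * r ≤ ε := by nlinarith
  set A := a + ε + 5 * δ with hA
  set B := 5 * ε / r with hB
  have hBr : B * r = 5 * ε := by rw [hB]; field_simp
  set T : ℝ × Y → ℝ := fun w => quadBarrier di κ y w + coneBarrier di A m B z.1 z.2 w with hT
  have core : ∀ t x, |t - z.1| ≤ r → x ∈ Xi → di x z.2 ≤ δ * r →
      T (t, x) - T z + 5 * δ * di x z.2 + B * (t - z.1) ^ 2 - 3 * ε * r ≤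
        ψ₁ (t, x) + ψ₂ (t, x) - (ψ₁ z + ψ₂ z) := by
    intro t x ht hx hxr
    have hq := hquad x hx (hxr.trans hδr)
    have hxz : di z.2 x ≤ r := by rw [hm.symm z.2 hz.2 x hx]; linarith
    have h₂ : ψ₂ z - ψ₂ (z.1, x) ≤ (a + ε) * di x z.2 := by
      refine hψ₂.sub_le_of_slopeSpWrt_lt hm hg (t := z.1) hz.1 hx hz.2 fun w hw hwx => ?_
      have h := hm.triangle z.2 hz.2 x hx w hw
      exact ((hbox z.1 (by simpa using hR)).2 w hw (by linarith)).2.2.1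
    have hτ : ∀ τ ∈ uIcc z.1 t, |τ - z.1| < R := fun τ hτ =>
      ((abs_sub_left_of_mem_uIcc hτ).trans ht).trans_lt (by linarith)
    have h₁ := abs_sub_sub_mul_le_of_hasDerivAt (f := fun τ => ψ₁ (τ, x) + ψ₂ (τ, x))
      (f' := fun τ => dψ₁ (τ, x) + dψ₂ (τ, x)) (a := z.1) (b := t) (m := m) (ε := ε)
      (fun τ h => (hd₁ (τ, x) ⟨(hbox τ (hτ τ h)).1, hx⟩).add
        (hd₂ (τ, x) ⟨(hbox τ (hτ τ h)).1, hx⟩))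
      (fun τ h => ((hbox τ (hτ τ h)).2 x hx (by linarith)).1.le)
    have h₃ := (abs_le.1 h₁).1
    have h₄ : ε * |t - z.1| ≤ ε * r := mul_le_mul_of_nonneg_left ht hε.le
    simp only [hT, coneBarrier, hm.refl z.2 hz.2, hA]
    have e : quadBarrier di κ y (t, x) = quadBarrier di κ y (z.1, x) := rfl
    rw [e]
    linarith
  have hmin' : ∀ t x, |t - z.1| ≤ r → x ∈ Xi → di x z.2 ≤ δ * r →
      |ψ₁ (t, x) + ψ₂ (t, x) - (ψ₁ z + ψ₂ z)| < θ / 2 ∧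
        ψ₁ (t, x) + ψ₂ (t, x) - (ψ₁ z + ψ₂ z) ≤ U (t, x) - U z := by
    intro t x ht hx hxr
    have h := (hbox t (by linarith)).2 x hx (by rw [hm.symm z.2 hz.2 x hx]; linarith)
    exact ⟨h.2.1, by linarith [h.2.2.2]⟩
  have hint : ∀ t x, |t - z.1| ≤ r → x ∈ Xi → di x z.2 ≤ δ * r →
      U (t, x) - T (t, x) ≤ U z - T z + ε * r / 3 → |t - z.1| < r ∧ di x z.2 < δ * r := by
    intro t x ht hx hxr hUT
    have h₁ := core t x ht hx hxr
    have h₂ := (hmin' t x ht hx hxr).2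
    have hnn : 0 ≤ 5 * δ * di x z.2 := mul_nonneg (by positivity) (hm.nonneg hx hz.2)
    have hnn' : 0 ≤ B * (t - z.1) ^ 2 := by positivity
    have hεr0 : 0 < ε * r := by positivity
    constructor
    · refine ht.lt_of_ne fun e => ?_
      have : B * (t - z.1) ^ 2 = 5 * ε * r := by rw [← sq_abs, e, ← hBr]; ring
      linarith
    · refine hxr.lt_of_ne fun e => ?_
      have : 5 * δ * di x z.2 = 5 * ε * r := by rw [e, hεdef]; ring
      linarith
  obtain ⟨t, x, v, q, ht, hx, hxr, hUv, hvT, hq, hqA, hH⟩ := S.exists_limit_point hsup hbdd hz hκ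
    (by positivity : 0 ≤ A) hy hr hrt (by positivity : 0 < δ * r)
    (by positivity : 0 < ε * r / 3) U hU T hT hint
  have h₁ := core t x ht.le hx hxr.le
  have h₂ := hmin' t x ht.le hx hxr.le
  have h₃ := abs_lt.1 h₂.1
  have hnn : 0 ≤ 5 * δ * di x z.2 := mul_nonneg (by positivity) (hm.nonneg hx hz.2)
  have hnn' : 0 ≤ B * (t - z.1) ^ 2 := by positivity
  refine ⟨t, x, v, q, by linarith [(abs_lt.1 ht).1], hx, ht.trans hrθ, by linarith,
    abs_lt.2 ⟨by linarith, by linarith⟩, hq, ?_, ?_⟩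
  · have h₄ := hslope δ hδ1 x hx hxr.le
    have h₅ := abs_sub_le q (2 * κ * di x y) p
    have h₆ : ε * δ ≤ δ := by nlinarith
    linarith
  · have h₄ : |B * (t - z.1)| ≤ 5 * ε := by
      rw [abs_mul, abs_of_nonneg (by positivity : 0 ≤ B), ← hBr]
      gcongr
    have h₅ := (abs_le.1 h₄).1
    linarith

/-- The lower semilimit of uniformly bounded supersolutions is a supersolution. -/
theorem IsStabilitySetup.isMVSupersolutionTWrt_lowerSemilimit
    (S : IsStabilitySetup X Xi d di H Hi)
    (hsup : ∀ n, IsMVSupersolutionTWrt (X n) (d n) (H n) (u n))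
    (hbdd : ∀ n, ∀ w ∈ Ioi (0 : ℝ) ×ˢ X n, |u n w| ≤ C) :
    IsMVSupersolutionTWrt Xi di Hi (lowerSemilimit X u) := by
  intro ψ₁ ψ₂ dψ₁ dψ₂ hψ₁ hψ₂ hd₁ hdc₁ hd₂ hdc₂ hc hup z hz hmin
  have hm := S.isMetricOn_lim
  set p := slopeSpWrt Xi di ψ₁ z
  set a := uscWrt (Ioi (0 : ℝ) ×ˢ Xi) (slopeSpWrt Xi di ψ₂) z
  set U := lscWrt (Ioi (0 : ℝ) ×ˢ Xi) (lowerSemilimit X u) with hU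
  set θ : ℕ → ℝ := fun k => 1 / ((k : ℝ) + 1) with hθ
  have hθ0 : Tendsto θ atTop (𝓝 0) := tendsto_one_div_add_atTop_nhds_zero_nat
  have hθ1 : ∀ k, θ k ≤ 1 := fun k => by
    rw [hθ]
    exact div_le_one_of_le₀ (by linarith [k.cast_nonneg (α := ℝ)]) (by positivity)
  choose t x v q ht hx htz hxz hvU hq hqp hH using fun k => S.exists_approx hsup hbdd hψ₁ hψ₂ hd₁
    hdc₁ hd₂ hdc₂ hc hup U hU hz hmin (show 0 < θ k by positivity)
  have hqmem : ∀ k, q k ∈ Icc 0 (p + a + 1) := fun k =>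
    ⟨hq k, by linarith [(abs_le.1 (hqp k)).2, hθ1 k]⟩
  obtain ⟨qs, hqs, σ, hσ, hqlim⟩ := isCompact_Icc.tendsto_subseq hqmem
  have hθσ := hθ0.comp hσ.tendsto_atTop
  have htlim : Tendsto t atTop (𝓝 z.1) := tendsto_iff_dist_tendsto_zero.2
    (squeeze_zero (fun _ => dist_nonneg) (fun k => (htz k).le) hθ0)
  have hvlim : Tendsto v atTop (𝓝 (U z)) := tendsto_iff_dist_tendsto_zero.2
    (squeeze_zero (fun _ => dist_nonneg) (fun k => (hvU k).le) hθ0)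
  have hxlim : Tendsto x atTop (𝓝 z.2) := tendsto_iff_dist_tendsto_zero.2
    (squeeze_zero (fun _ => dist_nonneg)
      (fun k => (hm.ge_dist _ (hx k) _ hz.2).trans (hxz k).le) hθ0)
  have hqsp : |qs - p| ≤ a := by
    have h := le_of_tendsto_of_tendsto' ((hqlim.sub_const p).abs) (hθσ.const_add a)
      fun k => hqp (σ k)
    simpa using h
  have hHlim : Tendsto (fun k => Hi (t (σ k)) (x (σ k)) (v (σ k)) (q (σ k))) atTop
      (𝓝 (Hi z.1 z.2 (U z) qs)) := by
    have hcont := S.continuousOn_lim ((z.1, z.2), U z, qs) ⟨⟨hz.1, hz.2⟩, mem_univ _, hqs.1⟩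
    refine hcont.tendsto.comp (f := fun k => ((t (σ k), x (σ k)), v (σ k), q (σ k)))
      (tendsto_nhdsWithin_iff.2 ⟨?_, Eventually.of_forall fun k =>
        ⟨⟨ht (σ k), hx (σ k)⟩, mem_univ _, hq (σ k)⟩⟩)
    exact ((htlim.comp hσ.tendsto_atTop).prodMk_nhds (hxlim.comp hσ.tendsto_atTop)).prodMk_nhds
      ((hvlim.comp hσ.tendsto_atTop).prodMk_nhds hqlim)
  have hlim : 0 ≤ dψ₁ z + dψ₂ z + 0 + Hi z.1 z.2 (U z) qs :=
    ge_of_tendsto' ((hθσ.const_add _).add hHlim) fun k => hH (σ k)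
  have hcompact : IsCompact {q : ℝ | 0 ≤ q ∧ |q - p| ≤ a} := by
    have hclosed : IsClosed {q : ℝ | 0 ≤ q ∧ |q - p| ≤ a} :=
      (isClosed_le continuous_const continuous_id).inter
        (isClosed_le (continuous_abs.comp (continuous_sub_right p)) continuous_const)
    exact (isCompact_closedBall p a).of_isClosed_subset hclosed fun q hq => hq.2
  have hbd : BddAbove (Hi z.1 z.2 (U z) '' {q | 0 ≤ q ∧ |q - p| ≤ a}) := by
    refine hcompact.bddAbove_image ?_
    exact S.continuousOn_lim.comp (f := fun q : ℝ => ((z.1, z.2), U z, q)) (by fun_prop)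
      fun q hq => ⟨⟨hz.1, hz.2⟩, mem_univ _, hq.1⟩
  have hle : Hi z.1 z.2 (U z) qs ≤ Hupp (fun w : ℝ × Y => Hi w.1 w.2) a z (U z) p :=
    le_csSup hbd (mem_image_of_mem _ ⟨hqs.1, hqsp⟩)
  linarith

end Stability

/-- STATEMENT 13: stability of metric viscosity supersolutions for the time-dependent
problem. -/
theorem stmt14 {Y : Type*} [MetricSpace Y] [LocallyCompactSpace Y]
    (X : ℕ → Set Y) (Xi : Set Y)
    (d : ℕ → Y → Y → ℝ) (di : Y → Y → ℝ)
    (H : ℕ → ℝ → Y → ℝ → ℝ → ℝ) (Hi : ℝ → Y → ℝ → ℝ → ℝ)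
    (u : ℕ → ℝ × Y → ℝ)
    (hXne : ∀ n, (X n).Nonempty) (hXc : ∀ n, IsCompact (X n))
    (hXine : Xi.Nonempty) (hXic : IsCompact Xi)
    (hmet : ∀ n, IsMetricOn (X n) (d n)) (hgeo : ∀ n, IsGeodesicWrt (X n) (d n))
    (hmeti : IsMetricOn Xi di) (hgeoi : IsGeodesicWrt Xi di)
    (hHc : ∀ n, ContinuousOn (fun q : (ℝ × Y) × ℝ × ℝ => H n q.1.1 q.1.2 q.2.1 q.2.2)
      ((Ioi (0:ℝ) ×ˢ X n) ×ˢ (univ : Set ℝ) ×ˢ Ici (0:ℝ)))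
    (hHic : ContinuousOn (fun q : (ℝ × Y) × ℝ × ℝ => Hi q.1.1 q.1.2 q.2.1 q.2.2)
      ((Ioi (0:ℝ) ×ˢ Xi) ×ˢ (univ : Set ℝ) ×ˢ Ici (0:ℝ)))
    (h1 : Tendsto (fun n => hausdorffDist (X n) Xi) atTop (𝓝 0))
    (h2 : ∀ a ∈ Xi, ∀ b ∈ Xi, ∀ an bn : ℕ → Y, (∀ n, an n ∈ X n) → (∀ n, bn n ∈ X n) →
      Tendsto an atTop (𝓝 a) → Tendsto bn atTop (𝓝 b) →
      Tendsto (fun n => d n (an n) (bn n)) atTop (𝓝 (di a b)))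
    (h3' : ∀ t ∈ Ioi (0:ℝ), ∀ x ∈ Xi, ∀ tn : ℕ → ℝ, (∀ n, tn n ∈ Ioi (0:ℝ)) →
      Tendsto tn atTop (𝓝 t) →
      ∀ xn : ℕ → Y, (∀ n, xn n ∈ X n) → Tendsto xn atTop (𝓝 x) →
      ∀ r p : ℝ, 0 ≤ p → ∀ rn pn : ℕ → ℝ, (∀ n, 0 ≤ pn n) →
      Tendsto rn atTop (𝓝 r) → Tendsto pn atTop (𝓝 p) →
      Tendsto (fun n => H n (tn n) (xn n) (rn n) (pn n)) atTop (𝓝 (Hi t x r p)))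
    (hsup : ∀ n, IsMVSupersolutionTWrt (X n) (d n) (H n) (u n))
    (hbdd : ∃ C : ℝ, ∀ n, ∀ t ∈ Ioi (0:ℝ), ∀ x ∈ X n, |u n (t, x)| ≤ C) :
    IsMVSupersolutionTWrt Xi di Hi (fun z : ℝ × Y => sInf {L : ℝ |
      ∃ tn : ℕ → ℝ, ∃ xn : ℕ → Y, (∀ n, xn n ∈ X n) ∧
        Tendsto tn atTop (𝓝 z.1) ∧ Tendsto xn atTop (𝓝 z.2) ∧
        Filter.liminf (fun n => u n (tn n, xn n)) atTop = L}) := by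
  obtain ⟨C, hC⟩ := hbdd
  have S : IsStabilitySetup X Xi d di H Hi :=
    ⟨hXne, hXc, hXine, hXic, hmet, hgeo, hmeti, hgeoi, hHic, h1, h2, h3'⟩
  exact S.isMVSupersolutionTWrt_lowerSemilimit hsup fun n w hw => hC n w.1 hw.1 w.2 hw.2
end

section
/- Let (X,d) be a complete metric space and let F : X → ℝ be upper semicontinuous and bounded from above. Then for each x̂ ∈ X, setting m := sup_X F − F(x̂), there exists x̄ ∈ X such that d(x̂, x̄) ≤ 1, F(x̄) ≥ F(x̂), and F(x) ≤ F(x̄) + m·d(x̄, x) for all x ∈ X; moreover, if m > 0 the inequality is strict for all x ≠ x̄, i.e. x ↦ F(x) − m·d(x̄, x) attains a strict maximum at x̄. -/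
open Filter Metric Set Topology

/-- Ekeland's variational principle with slope `c`, in the form of the existence of a point above
`a` that is maximal for the order `F x + c * dist x y ≤ F y`. -/
theorem UpperSemicontinuous.exists_ekeland_maximal {X : Type*} [MetricSpace X] [CompleteSpace X]
    {F : X → ℝ} (hF : UpperSemicontinuous F) (hbd : BddAbove (Set.range F)) {c : ℝ} (hc : 0 < c)
    (a : X) :
    ∃ b : X, F a + c * dist a b ≤ F b ∧ ∀ x, x ≠ b → F x < F b + c * dist b x := by
  let S : X → Set X := fun x => {y | F x + c * dist x y ≤ F y}
  have self_mem (x : X) : x ∈ S x := by simp [S]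
  have trans {x y z : X} (hy : y ∈ S x) (hz : z ∈ S y) : z ∈ S x := by
    simp only [S, Set.mem_ofPred_eq] at *
    nlinarith [mul_le_mul_of_nonneg_left (dist_triangle x y z) hc.le]
  have closed (x : X) : IsClosed (S x) := by
    have h : UpperSemicontinuous fun y => F y + -(c * dist x y) :=
      hF.add (Continuous.upperSemicontinuous (by fun_prop))
    convert h.isClosed_preimage (F x) using 1
    ext y
    simp only [S, Set.mem_ofPred_eq, Set.mem_preimage, Set.mem_Ici]
    constructor <;> intro h <;> linarith
  have step (x : X) (n : ℕ) : ∃ y ∈ S x, ∀ z ∈ S x, F z ≤ F y + (1 / 2 : ℝ) ^ n := by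
    have hb : BddAbove (F '' S x) := hbd.mono (Set.image_subset_range _ _)
    obtain ⟨_, ⟨y, hy, rfl⟩, hlt⟩ := exists_lt_of_lt_csSup (Set.Nonempty.image F ⟨x, self_mem x⟩)
      (sub_lt_self (sSup (F '' S x)) (show (0 : ℝ) < (1 / 2) ^ n by positivity))
    exact ⟨y, hy, fun z hz => by linarith [le_csSup hb (Set.mem_image_of_mem F hz)]⟩
  choose next next_mem next_le using step
  let u : ℕ → X := fun n => Nat.rec a (fun n x => next x n) n
  have u_mem {m n : ℕ} (h : m ≤ n) : u n ∈ S (u m) := by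
    induction n, h using Nat.le_induction with
    | base => exact self_mem _
    | succ n _ ih => exact trans ih (next_mem (u n) n)
  have dist_le (n : ℕ) {y : X} (hy : y ∈ S (u (n + 1))) :
      dist (u (n + 1)) y ≤ (1 / 2 : ℝ) ^ n / c := by
    have h : F y ≤ F (u (n + 1)) + (1 / 2 : ℝ) ^ n :=
      next_le (u n) n y (trans (next_mem (u n) n) hy)
    rw [le_div_iff₀ hc]
    simp only [S, Set.mem_ofPred_eq] at hy
    linarith
  have bound_tendsto : Tendsto (fun n : ℕ => (1 / 2 : ℝ) ^ n / c) atTop (𝓝 0) := by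
    simpa using (tendsto_pow_atTop_nhds_zero_of_lt_one (r := (1 / 2 : ℝ))
      (by norm_num) (by norm_num)).div_const c
  have cauchy : CauchySeq fun n => u (n + 1) := by
    refine cauchySeq_of_le_tendsto_0 (fun n => (1 / 2 : ℝ) ^ n / c + (1 / 2 : ℝ) ^ n / c)
      (fun n m N hn hm => ?_) (by simpa using bound_tendsto.add bound_tendsto)
    exact (dist_triangle_left _ _ (u (N + 1))).trans
      (add_le_add (dist_le N (u_mem (Nat.succ_le_succ hn)))
        (dist_le N (u_mem (Nat.succ_le_succ hm))))
  obtain ⟨b, hb⟩ := cauchySeq_tendsto_of_complete cauchy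
  have b_mem (n : ℕ) : b ∈ S (u n) :=
    (closed (u n)).mem_of_tendsto hb <|
      (eventually_ge_atTop n).mono fun m hm => u_mem (Nat.le_succ_of_le hm)
  refine ⟨b, b_mem 0, fun x hx => ?_⟩
  by_contra! h
  exact hx <| tendsto_nhds_unique (tendsto_iff_dist_tendsto_zero.2 <|
    squeeze_zero (fun _ => dist_nonneg) (fun n => dist_le n (trans (b_mem (n + 1)) h))
      bound_tendsto) hb

/-- Ekeland's variational principle, upper semicontinuous form. -/
theorem stmt15 {X : Type*} [MetricSpace X] [CompleteSpace X]
    (F : X → ℝ) (hF : UpperSemicontinuous F) (hbd : BddAbove (Set.range F))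
    (xhat : X) :
    ∃ xbar : X, dist xhat xbar ≤ 1 ∧ F xhat ≤ F xbar ∧
      (∀ x : X, F x ≤ F xbar + (sSup (Set.range F) - F xhat) * dist xbar x) ∧
      (0 < sSup (Set.range F) - F xhat →
        ∀ x : X, x ≠ xbar → F x < F xbar + (sSup (Set.range F) - F xhat) * dist xbar x) := by
  have le_sup (x : X) : F x ≤ sSup (Set.range F) := le_csSup hbd (Set.mem_range_self x)
  rcases (sub_nonneg.2 (le_sup xhat)).eq_or_lt with hm | hm
  · refine ⟨xhat, by simp, le_rfl, fun x => ?_, fun h => absurd h (by simp [← hm])⟩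
    rw [← hm]
    linarith [le_sup x]
  · obtain ⟨b, hab, hb⟩ := hF.exists_ekeland_maximal hbd hm xhat
    refine ⟨b, ?_, ?_, fun x => ?_, fun _ => hb⟩
    · refine le_of_mul_le_mul_left ?_ hm
      linarith [le_sup b]
    · linarith [mul_nonneg hm.le (dist_nonneg (x := xhat) (y := b))]
    · rcases eq_or_ne x b with rfl | hx
      · simp
      · exact (hb x hx).le
end

section
/- Let (X,d) be a complete geodesic metric space (not necessarily locally compact), H : X × ℝ × [0,∞) → ℝ continuous, and u : X → ℝ locally bounded. Then the following are equivalent: (i) u is a metric viscosity subsolution of H(x, u, |∇u|) = 0; (ii) for all â, b̂, x̂ ∈ X and k, c ≥ 0, if x ↦ u*(x) − (k/2) d(â,x)² − c·d(b̂,x) attains a local maximum at x = x̂, then H_c(x̂, u*(x̂), k·d(â,x̂)) ≤ 0; (iii) the same as (ii) with strict local maximum. -/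
open Filter Metric Set Topology

section Ekeland

theorem UpperSemicontinuous.sub_continuous {X : Type*} [TopologicalSpace X] {f g : X → ℝ}
    (hf : UpperSemicontinuous f) (hg : Continuous g) :
    UpperSemicontinuous fun x => f x - g x := by
  simp only [sub_eq_add_neg]
  exact hf.add hg.neg.upperSemicontinuous

/-- **Ekeland's variational principle** for an upper semicontinuous function which is bounded
above on a closed set. -/
theorem UpperSemicontinuous.exists_ekeland {X : Type*} [MetricSpace X] [CompleteSpace X]
    {f : X → ℝ} (hf : UpperSemicontinuous f) {S : Set X} (hS : IsClosed S) {x₀ : X} (hx₀ : x₀ ∈ S)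
    {M δ : ℝ} (hM : ∀ y ∈ S, f y ≤ M) (hδ : 0 < δ) :
    ∃ z ∈ S, f x₀ + δ * dist x₀ z ≤ f z ∧ ∀ y ∈ S, f y ≤ f z + δ * dist z y := by
  let T : X → Set X := fun x => {y | y ∈ S ∧ f x + δ * dist x y ≤ f y}
  have hself : ∀ x ∈ S, x ∈ T x := fun x hx => ⟨hx, by simp⟩
  have htrans : ∀ {x y w}, y ∈ T x → w ∈ T y → w ∈ T x := by
    rintro x y w ⟨-, h1⟩ ⟨hw, h2⟩
    refine ⟨hw, ?_⟩
    nlinarith [dist_triangle x y w]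
  have hstep : ∀ (n : ℕ) (x : S), ∃ y : S, (y : X) ∈ T x ∧
      ∀ w ∈ T x, f w ≤ f y + δ * (1 / 2) ^ n := by
    intro n x
    have hbdd : BddAbove (f '' T x) := ⟨M, by rintro _ ⟨y, hy, rfl⟩; exact hM y hy.1⟩
    have hne : (f '' T x).Nonempty := ⟨_, x, hself x x.2, rfl⟩
    have hη : 0 < δ * (1 / 2) ^ n := by positivity
    obtain ⟨_, ⟨y, hy, rfl⟩, hlt⟩ := exists_lt_of_lt_csSup hne (sub_lt_self _ hη)
    refine ⟨⟨y, hy.1⟩, hy, fun w hw => ?_⟩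
    have := le_csSup hbdd ⟨w, hw, rfl⟩
    simp only
    linarith
  choose F hFT hFmax using hstep
  obtain ⟨x, hx_zero, hx⟩ : ∃ x : ℕ → S, x 0 = ⟨x₀, hx₀⟩ ∧ ∀ n, x (n + 1) = F n (x n) :=
    ⟨fun n => Nat.rec ⟨x₀, hx₀⟩ F n, rfl, fun _ => rfl⟩
  have hxT : ∀ n m : ℕ, n ≤ m → (x m : X) ∈ T (x n) := by
    intro n m h
    induction m, h using Nat.le_induction with
    | base => exact hself (x n) (x n).2
    | succ m _ ih => exact htrans ih (hx m ▸ hFT m (x m))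
  have hdist : ∀ n, dist (x (n + 1) : X) (x (n + 1 + 1)) ≤ 1 * (1 / 2) ^ n := by
    intro n
    have h1 := (hxT (n + 1) (n + 1 + 1) (by lia)).2
    have h2 := hFmax n (x n) _ (hxT n (n + 1 + 1) (by lia))
    rw [← hx] at h2
    have : δ * dist (x (n + 1) : X) (x (n + 1 + 1)) ≤ δ * (1 / 2) ^ n := by linarith
    rw [one_mul]
    exact le_of_mul_le_mul_left this hδ
  obtain ⟨z, hz⟩ := cauchySeq_tendsto_of_complete
    (cauchySeq_of_le_geometric (f := fun n => (x (n + 1) : X)) (1 / 2) 1 (by norm_num) hdist)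
  have hzS : z ∈ S := hS.mem_of_tendsto hz (Eventually.of_forall fun n => (x (n + 1)).2)
  have hzT : ∀ n, z ∈ T (x n) := by
    intro n
    refine ⟨hzS, ?_⟩
    by_contra! hlt
    have husc := hf.sub_continuous (g := fun y => δ * dist (x n : X) y) (by fun_prop)
    have h1 := hz.eventually (husc z (f (x n)) (by linarith))
    obtain ⟨m, hm, hnm⟩ := (h1.and (eventually_ge_atTop n)).exists
    have := (hxT n (m + 1) (by lia)).2
    linarith
  refine ⟨z, hzS, by simpa [hx_zero] using (hzT 0).2, fun y hy => ?_⟩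
  by_contra! hlt
  have hyT : ∀ n, y ∈ T (x n) := fun n => htrans (hzT n) ⟨hy, hlt.le⟩
  have hle : ∀ n : ℕ, f y ≤ f z + δ * (1 / 2) ^ n := by
    intro n
    have h1 := hFmax n (x n) y (hyT n)
    rw [← hx] at h1
    have h2 := (hzT (n + 1)).2
    have : 0 ≤ δ * dist (x (n + 1) : X) z := by positivity
    linarith
  have hlim : Tendsto (fun n : ℕ => f z + δ * (1 / 2 : ℝ) ^ n) atTop (𝓝 (f z + δ * 0)) :=
    ((tendsto_pow_atTop_nhds_zero_of_lt_one (by norm_num) (by norm_num)).const_mul δ).const_add _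
  have := ge_of_tendsto' hlim hle
  have : 0 ≤ δ * dist z y := by positivity
  linarith

end Ekeland

section Limsup

theorem limsup_nonneg_of_forall {α : Type*} {l : Filter α} {g : α → ℝ} (hg : ∀ y, 0 ≤ g y) :
    0 ≤ limsup g l := by
  rcases l.eq_or_neBot with rfl | _
  · simp [limsup, limsSup]
  · exact Real.sInf_nonneg fun a ha =>
      let ⟨y, hy⟩ := (Filter.eventually_map.1 ha).exists
      (hg y).trans hy

theorem limsup_le_of_nonneg {α : Type*} {l : Filter α} {g : α → ℝ} {M : ℝ} (hg : ∀ y, 0 ≤ g y)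
    (hM : 0 ≤ M) (h : ∀ᶠ y in l, g y ≤ M) : limsup g l ≤ M := by
  rcases l.eq_or_neBot with rfl | _
  · simpa [limsup, limsSup] using hM
  · exact limsup_le_of_le (isCoboundedUnder_le_of_le l hg) h

variable {X : Type*} [MetricSpace X]

theorem LocLipWrt.exists_ball {ψ : X → ℝ} (hψ : LocLipWrt univ dist ψ) (x : X) :
    ∃ K : ℝ, 0 ≤ K ∧ ∃ r > 0, ∀ y ∈ ball x r, ∀ z ∈ ball x r, |ψ y - ψ z| ≤ K * dist y z := by
  obtain ⟨K, t, ht, h⟩ := hψ x (mem_univ x)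
  rw [nhdsWithin_univ] at ht
  obtain ⟨r, hr, hrt⟩ := Metric.mem_nhds_iff.1 ht
  refine ⟨max K 0, le_max_right _ _, r, hr, fun y hy z hz => ?_⟩
  refine (h y ⟨hrt hy, mem_univ _⟩ z ⟨hrt hz, mem_univ _⟩).trans ?_
  gcongr
  exact le_max_left _ _

theorem LocLipWrt.continuous {ψ : X → ℝ} (hψ : LocLipWrt univ dist ψ) : Continuous ψ := by
  refine continuous_iff_continuousAt.2 fun x => ?_
  obtain ⟨K, -, r, hr, h⟩ := hψ.exists_ball x
  refine tendsto_iff_dist_tendsto_zero.2 ?_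
  have h0 : Tendsto (fun y => K * dist y x) (𝓝 x) (𝓝 (K * dist x x)) :=
    Continuous.tendsto (by fun_prop) x
  rw [dist_self, mul_zero] at h0
  refine squeeze_zero' (Eventually.of_forall fun _ => dist_nonneg) ?_ h0
  filter_upwards [ball_mem_nhds x hr] with y hy
  exact h y hy x (mem_ball_self hr)

theorem slope_quotient_nonneg (ψ : X → ℝ) (x y : X) : 0 ≤ |ψ y - ψ x| / dist x y := by
  positivity

theorem lower_slope_quotient_nonneg (ψ : X → ℝ) (x y : X) :
    0 ≤ max (ψ x - ψ y) 0 / dist x y := by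
  positivity

theorem slopeWrt_nonneg (ψ : X → ℝ) (x : X) : 0 ≤ slopeWrt univ dist ψ x :=
  limsup_nonneg_of_forall (slope_quotient_nonneg ψ x)

theorem uscWrt_slopeWrt_nonneg (ψ : X → ℝ) (x : X) :
    0 ≤ uscWrt univ (slopeWrt univ dist ψ) x :=
  limsup_nonneg_of_forall (slopeWrt_nonneg ψ)

theorem slope_quotient_le_of_lip {ψ : X → ℝ} {x : X} {K r : ℝ} (hK : 0 ≤ K)
    (h : ∀ y ∈ ball x r, ∀ z ∈ ball x r, |ψ y - ψ z| ≤ K * dist y z) {y z : X}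
    (hy : y ∈ ball x r) (hz : z ∈ ball x r) : |ψ z - ψ y| / dist y z ≤ K := by
  refine div_le_of_le_mul₀ dist_nonneg hK ?_
  rw [dist_comm]
  exact h z hz y hy

theorem slopeWrt_le_of_lip {ψ : X → ℝ} {x : X} {K r : ℝ} (hK : 0 ≤ K)
    (h : ∀ y ∈ ball x r, ∀ z ∈ ball x r, |ψ y - ψ z| ≤ K * dist y z) {y : X}
    (hy : y ∈ ball x r) : slopeWrt univ dist ψ y ≤ K := by
  refine limsup_le_of_nonneg (slope_quotient_nonneg ψ y) hK ?_
  filter_upwards [mem_nhdsWithin_of_mem_nhds (isOpen_ball.mem_nhds hy)] with z hz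
  exact slope_quotient_le_of_lip hK h hy hz

theorem LocLipWrt.eventually_quotient_lt {ψ : X → ℝ} (hψ : LocLipWrt univ dist ψ) {x : X} {M : ℝ}
    (h : slopeWrt univ dist ψ x < M) :
    ∀ᶠ y in 𝓝[≠] x, |ψ y - ψ x| / dist x y < M := by
  obtain ⟨K, hK, r, hr, hl⟩ := hψ.exists_ball x
  rw [compl_eq_univ_sdiff]
  refine eventually_lt_of_limsup_lt h (isBoundedUnder_of_eventually_le (a := K) ?_)
  filter_upwards [mem_nhdsWithin_of_mem_nhds (ball_mem_nhds x hr)] with z hz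
  exact slope_quotient_le_of_lip hK hl (mem_ball_self hr) hz

theorem LocLipWrt.eventually_slopeWrt_lt {ψ : X → ℝ} (hψ : LocLipWrt univ dist ψ) {x : X} {M : ℝ}
    (h : uscWrt univ (slopeWrt univ dist ψ) x < M) :
    ∀ᶠ y in 𝓝 x, slopeWrt univ dist ψ y < M := by
  obtain ⟨K, hK, r, hr, hl⟩ := hψ.exists_ball x
  rw [← nhdsWithin_univ]
  refine eventually_lt_of_limsup_lt h (isBoundedUnder_of_eventually_le (a := K) ?_)
  filter_upwards [mem_nhdsWithin_of_mem_nhds (ball_mem_nhds x hr)] with z hz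
  exact slopeWrt_le_of_lip hK hl hz

theorem frequently_lt_of_lt_lowerSlopeWrt {ψ : X → ℝ} {x : X} {m : ℝ} (hm : 0 ≤ m)
    (h : m < lowerSlopeWrt univ dist ψ x) :
    ∃ᶠ y in 𝓝[≠] x, m * dist x y < ψ x - ψ y := by
  by_contra hcon
  rw [not_frequently] at hcon
  refine h.not_ge (limsup_le_of_nonneg (lower_slope_quotient_nonneg ψ x) hm ?_)
  rw [← compl_eq_univ_sdiff]
  filter_upwards [hcon] with y hy
  exact div_le_of_le_mul₀ dist_nonneg hm (max_le (not_lt.1 hy) (by positivity))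

theorem LocBddWrt.upperSemicontinuous_uscWrt {u : X → ℝ} (hu : LocBddWrt univ u) :
    UpperSemicontinuous (uscWrt univ u) := by
  have hu' : ∀ x, ∃ C : ℝ, ∀ᶠ y in 𝓝 x, |u y| ≤ C := fun x => by
    simpa only [nhdsWithin_univ] using hu x (mem_univ x)
  have heq : ∀ x, uscWrt univ u x = limsup u (𝓝 x) := fun x => by
    rw [uscWrt, nhdsWithin_univ]
  intro x v hv
  rw [heq] at hv
  obtain ⟨w, hw, hwv⟩ := exists_between hv
  obtain ⟨C, hC⟩ := hu' x
  have h := eventually_lt_of_limsup_lt hw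
    (isBoundedUnder_of_eventually_le (a := C) (hC.mono fun y hy => (abs_le.1 hy).2))
  filter_upwards [h.eventually_nhds] with y hy
  rw [heq]
  obtain ⟨D, hD⟩ := hu' y
  refine (limsup_le_of_le ?_ (hy.mono fun z hz => hz.le)).trans_lt hwv
  exact (isBoundedUnder_of_eventually_ge (a := -D)
    (hD.mono fun y hy => (abs_le.1 hy).1)).isCoboundedUnder_le

end Limsup

section Geodesic

variable {X : Type*} [MetricSpace X]

/-- Along a geodesic, a bound on the local slope integrates to a Lipschitz bound. -/
theorem LocLipWrt.sub_le_of_slopeWrt_le (hgeo : IsGeodesicWrt (univ : Set X) dist) {ψ : X → ℝ}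
    (hψ : LocLipWrt univ dist ψ) {x y : X} {M : ℝ}
    (hM : ∀ w, dist x w ≤ dist x y → slopeWrt univ dist ψ w ≤ M) :
    ψ y - ψ x ≤ M * dist x y := by
  obtain ⟨γ, h0, h1, -, hγ⟩ := hgeo x (mem_univ x) y (mem_univ y)
  have hd : (0 : ℝ) ≤ dist x y := dist_nonneg
  have hγc : ContinuousOn γ (Icc 0 (dist x y)) := by
    refine (LipschitzOnWith.of_dist_le_mul (K := 1) fun s hs t ht => ?_).continuousOn
    rw [hγ s hs t ht, Real.dist_eq, NNReal.coe_one, one_mul]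
  have hB : ∀ t : ℝ, HasDerivAt (fun t : ℝ => ψ x + M * t) M t := fun t => by
    simpa using ((hasDerivAt_id t).const_mul M).const_add (ψ x)
  have key := image_le_of_liminf_slope_right_le_deriv_boundary (f := fun t => ψ (γ t))
    (a := 0) (b := dist x y) (B := fun t => ψ x + M * t) (B' := fun _ => M)
    (hψ.continuous.comp_continuousOn hγc) (by simp [h0]) (by fun_prop)
    (fun t _ => (hB t).hasDerivWithinAt) ?_ (right_mem_Icc.2 hd)
  · simp only [h1] at key
    linarith
  intro t ht r hr
  have htI : t ∈ Icc 0 (dist x y) := Ico_subset_Icc_self ht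
  have hxt : dist x (γ t) ≤ dist x y := by
    rw [← h0, hγ 0 (left_mem_Icc.2 hd) t htI, h0, zero_sub, abs_neg, abs_of_nonneg ht.1]
    exact ht.2.le
  have hev := hψ.eventually_quotient_lt ((hM _ hxt).trans_lt hr)
  have hIoo : Ioo t (dist x y) ∈ 𝓝[>] t := Ioo_mem_nhdsGT ht.2
  have htend : Tendsto γ (𝓝[>] t) (𝓝[≠] γ t) := by
    refine tendsto_nhdsWithin_iff.2 ⟨?_, ?_⟩
    · refine (hγc t htI).mono_left ?_
      rw [← nhdsWithin_Ioo_eq_nhdsGT ht.2]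
      exact nhdsWithin_mono _ fun s hs => ⟨ht.1.trans hs.1.le, hs.2.le⟩
    · filter_upwards [hIoo] with s hs heq
      have := hγ s ⟨ht.1.trans hs.1.le, hs.2.le⟩ t htI
      rw [mem_singleton_iff.1 heq, dist_self] at this
      exact (abs_pos.2 (sub_pos.2 hs.1).ne').ne this
  refine Eventually.frequently ?_
  filter_upwards [htend.eventually hev, hIoo] with s hs hsI
  rw [hγ t htI s ⟨ht.1.trans hsI.1.le, hsI.2.le⟩, abs_sub_comm t s,
    abs_of_pos (sub_pos.2 hsI.1)] at hs
  rw [slope_def_field]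
  refine lt_of_le_of_lt ?_ hs
  have := sub_pos.2 hsI.1
  gcongr
  exact le_abs_self _

theorem abs_half_sq_dist_sub_le (a x y : X) {k : ℝ} (hk : 0 ≤ k) :
    |k / 2 * dist a y ^ 2 - k / 2 * dist a x ^ 2| ≤
      k / 2 * (dist a y + dist a x) * dist x y := by
  have h : |dist a y - dist a x| ≤ dist x y := by
    rw [dist_comm a y, dist_comm a x, dist_comm x y]
    exact abs_dist_sub_le y x a
  have hs : 0 ≤ k / 2 * (dist a y + dist a x) := by positivity
  calc |k / 2 * dist a y ^ 2 - k / 2 * dist a x ^ 2|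
      = k / 2 * (dist a y + dist a x) * |dist a y - dist a x| := by
        rw [show k / 2 * dist a y ^ 2 - k / 2 * dist a x ^ 2 =
          k / 2 * (dist a y + dist a x) * (dist a y - dist a x) by ring, abs_mul,
          abs_of_nonneg hs]
    _ ≤ _ := by gcongr

theorem locLipWrt_half_sq_dist (a : X) {k : ℝ} (hk : 0 ≤ k) :
    LocLipWrt univ dist fun x => k / 2 * dist a x ^ 2 := by
  intro x _
  refine ⟨k / 2 * ((dist a x + 1) + (dist a x + 1)), ball x 1,
    mem_nhdsWithin_of_mem_nhds (ball_mem_nhds x one_pos), fun y hy z hz => ?_⟩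
  have hy' : dist a y ≤ dist a x + 1 := by
    have := mem_ball.1 hy.1
    have := dist_triangle a x y
    rw [dist_comm x y] at this
    linarith
  have hz' : dist a z ≤ dist a x + 1 := by
    have := mem_ball.1 hz.1
    have := dist_triangle a x z
    rw [dist_comm x z] at this
    linarith
  rw [dist_comm y z]
  refine (abs_half_sq_dist_sub_le a z y hk).trans ?_
  gcongr

theorem eventually_half_sq_dist_quotient_le (a x : X) {k η : ℝ} (hk : 0 ≤ k) (hη : 0 < η) :
    ∀ᶠ y in 𝓝 x, |k / 2 * dist a y ^ 2 - k / 2 * dist a x ^ 2| / dist x y ≤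
      k * dist a x + η := by
  have hc : Tendsto (fun y => k / 2 * (dist a y + dist a x)) (𝓝 x)
      (𝓝 (k / 2 * (dist a x + dist a x))) := Continuous.tendsto (by fun_prop) x
  have hlt : k / 2 * (dist a x + dist a x) < k * dist a x + η := by linarith
  filter_upwards [hc.eventually_lt_const hlt] with y hy
  refine div_le_of_le_mul₀ dist_nonneg (by positivity) ?_
  refine (abs_half_sq_dist_sub_le a x y hk).trans ?_
  gcongr

theorem slopeWrt_half_sq_dist_le (a x : X) {k : ℝ} (hk : 0 ≤ k) :
    slopeWrt univ dist (fun x => k / 2 * dist a x ^ 2) x ≤ k * dist a x := by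
  refine le_of_forall_pos_le_add fun η hη => ?_
  exact limsup_le_of_nonneg (slope_quotient_nonneg _ x) (by positivity)
    (eventually_nhdsWithin_of_eventually_nhds (eventually_half_sq_dist_quotient_le a x hk hη))

theorem lowerSlopeWrt_half_sq_dist_le (a x : X) {k : ℝ} (hk : 0 ≤ k) :
    lowerSlopeWrt univ dist (fun x => k / 2 * dist a x ^ 2) x ≤ k * dist a x := by
  refine le_of_forall_pos_le_add fun η hη => ?_
  refine limsup_le_of_nonneg (lower_slope_quotient_nonneg (fun x => k / 2 * dist a x ^ 2) x)
    (by positivity) ?_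
  filter_upwards [eventually_nhdsWithin_of_eventually_nhds
    (eventually_half_sq_dist_quotient_le a x hk hη)] with y hy
  refine le_trans ?_ hy
  gcongr
  rw [abs_sub_comm]
  exact max_le (le_abs_self _) (abs_nonneg _)

/-- Moving from `x` towards `a` decreases the squared distance at the optimal rate. -/
theorem frequently_half_sq_dist_quotient (hgeo : IsGeodesicWrt (univ : Set X) dist) {a x : X}
    (hax : 0 < dist a x) {k η : ℝ} (hη : 0 < η) :
    ∃ᶠ y in 𝓝[≠] x, k * dist a x - η <
      (k / 2 * dist a x ^ 2 - k / 2 * dist a y ^ 2) / dist x y := by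
  obtain ⟨γ, h0, h1, -, hγ⟩ := hgeo x (mem_univ x) a (mem_univ a)
  have hd : 0 < dist x a := by rwa [dist_comm]
  have hx : ∀ t ∈ Ioo 0 (dist x a), dist x (γ t) = t := fun t ht => by
    have := hγ 0 (left_mem_Icc.2 hd.le) t (Ioo_subset_Icc_self ht)
    rwa [h0, zero_sub, abs_neg, abs_of_pos ht.1] at this
  have ha : ∀ t ∈ Ioo 0 (dist x a), dist a (γ t) = dist a x - t := fun t ht => by
    nth_rewrite 1 [← h1]
    rw [hγ _ (right_mem_Icc.2 hd.le) t (Ioo_subset_Icc_self ht), abs_of_pos (sub_pos.2 ht.2),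
      dist_comm]
  have hIoo : Ioo 0 (dist x a) ∈ 𝓝[>] (0 : ℝ) := Ioo_mem_nhdsGT hd
  have htend : Tendsto γ (𝓝[>] 0) (𝓝[≠] x) := by
    refine tendsto_nhdsWithin_iff.2 ⟨?_, ?_⟩
    · rw [tendsto_iff_dist_tendsto_zero]
      have hid : Tendsto (fun t : ℝ => t) (𝓝[>] 0) (𝓝 0) := tendsto_id.mono_left nhdsWithin_le_nhds
      refine hid.congr' ?_
      filter_upwards [hIoo] with t ht
      rw [dist_comm, hx t ht]
    · filter_upwards [hIoo] with t ht heq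
      have := hx t ht
      rw [mem_singleton_iff.1 heq, dist_self] at this
      exact ht.1.ne this
  have hc : Tendsto (fun t => k * dist a x - k / 2 * t) (𝓝[>] 0)
      (𝓝 (k * dist a x - k / 2 * 0)) :=
    (Continuous.tendsto (by fun_prop) 0).mono_left nhdsWithin_le_nhds
  refine htend.frequently (Eventually.frequently ?_)
  filter_upwards [hc.eventually_const_lt (u := k * dist a x - η) (by linarith), hIoo]
    with t ht htI
  refine ht.trans_eq ?_
  rw [hx t htI, ha t htI]
  have := htI.1.ne'
  field_simp
  ring

theorem slopeWrt_half_sq_dist (hgeo : IsGeodesicWrt (univ : Set X) dist) (a x : X) {k : ℝ}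
    (hk : 0 ≤ k) : slopeWrt univ dist (fun x => k / 2 * dist a x ^ 2) x = k * dist a x := by
  refine (slopeWrt_half_sq_dist_le a x hk).antisymm ?_
  rcases (dist_nonneg : 0 ≤ dist a x).eq_or_lt with h | h
  · rw [← h, mul_zero]
    exact slopeWrt_nonneg _ x
  refine le_of_forall_sub_le fun η hη => ?_
  by_contra! hlt
  obtain ⟨y, hy, hy'⟩ := ((frequently_half_sq_dist_quotient hgeo h (k := k) hη).and_eventually
    ((locLipWrt_half_sq_dist a hk).eventually_quotient_lt hlt)).exists
  refine (hy.trans_le ?_).not_gt hy'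
  gcongr
  rw [abs_sub_comm]
  exact le_abs_self _

theorem lowerSlopeWrt_half_sq_dist (hgeo : IsGeodesicWrt (univ : Set X) dist) (a x : X) {k : ℝ}
    (hk : 0 ≤ k) :
    lowerSlopeWrt univ dist (fun x => k / 2 * dist a x ^ 2) x = k * dist a x := by
  refine (lowerSlopeWrt_half_sq_dist_le a x hk).antisymm ?_
  rcases (dist_nonneg : 0 ≤ dist a x).eq_or_lt with h | h
  · rw [← h, mul_zero]
    exact limsup_nonneg_of_forall (lower_slope_quotient_nonneg (fun x => k / 2 * dist a x ^ 2) x)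
  refine le_of_forall_sub_le fun η hη => ?_
  have hfreq := frequently_half_sq_dist_quotient hgeo h (k := k) hη
  rw [compl_eq_univ_sdiff] at hfreq
  refine le_limsup_of_frequently_le (hfreq.mono fun y hy => hy.le.trans ?_)
    (isBoundedUnder_of_eventually_le (a := k * dist a x + 1) ?_)
  · gcongr
    exact le_max_left _ _
  · filter_upwards [eventually_nhdsWithin_of_eventually_nhds
      (eventually_half_sq_dist_quotient_le a x hk one_pos)] with y hy
    refine le_trans ?_ hy
    gcongr
    rw [abs_sub_comm]
    exact max_le (le_abs_self _) (abs_nonneg _)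

theorem isC1MinusWrt_half_sq_dist (hgeo : IsGeodesicWrt (univ : Set X) dist) (a : X) {k : ℝ}
    (hk : 0 ≤ k) : IsC1MinusWrt univ dist fun x => k / 2 * dist a x ^ 2 := by
  refine ⟨locLipWrt_half_sq_dist a hk, ?_, fun x _ => ?_⟩
  · have hc : Continuous fun x => k * dist a x := by fun_prop
    exact hc.continuousOn.congr fun x _ => slopeWrt_half_sq_dist hgeo a x hk
  · rw [slopeWrt_half_sq_dist hgeo a x hk, lowerSlopeWrt_half_sq_dist hgeo a x hk]

theorem abs_mul_dist_sub_le (b y z : X) {c : ℝ} (hc : 0 ≤ c) :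
    |c * dist b y - c * dist b z| ≤ c * dist y z := by
  rw [← mul_sub, abs_mul, abs_of_nonneg hc]
  gcongr
  rw [dist_comm b y, dist_comm b z]
  exact abs_dist_sub_le y z b

theorem locLipWrt_mul_dist (b : X) {c : ℝ} (hc : 0 ≤ c) :
    LocLipWrt univ dist fun x => c * dist b x :=
  fun _ _ => ⟨c, univ, univ_mem, fun y _ z _ => abs_mul_dist_sub_le b y z hc⟩

theorem uscWrt_slopeWrt_mul_dist_le (b x : X) {c : ℝ} (hc : 0 ≤ c) :
    uscWrt univ (slopeWrt univ dist fun x => c * dist b x) x ≤ c :=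
  limsup_le_of_nonneg (slopeWrt_nonneg _) hc (Eventually.of_forall fun _ =>
    slopeWrt_le_of_lip (r := 1) hc (fun z _ w _ => abs_mul_dist_sub_le b z w hc)
      (mem_ball_self one_pos))

end Geodesic

section Hamiltonian

variable {X : Type*} [MetricSpace X] {H : X → ℝ → ℝ → ℝ}

theorem Hlow_nonpos_iff
    (hH : ContinuousOn (fun q : X × ℝ × ℝ => H q.1 q.2.1 q.2.2)
      ((univ : Set X) ×ˢ (univ : Set ℝ) ×ˢ Ici (0 : ℝ)))
    {a p : ℝ} (ha : 0 ≤ a) (hp : 0 ≤ p) (x : X) (r : ℝ) :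
    Hlow H a x r p ≤ 0 ↔ ∃ q, 0 ≤ q ∧ |q - p| ≤ a ∧ H x r q ≤ 0 := by
  have hset : {q | 0 ≤ q ∧ |q - p| ≤ a} = Ici 0 ∩ closedBall p a := by
    ext q
    simp [Real.dist_eq]
  have hcomp : IsCompact (H x r '' {q | 0 ≤ q ∧ |q - p| ≤ a}) := by
    rw [hset]
    refine ((isCompact_closedBall p a).inter_left isClosed_Ici).image_of_continuousOn ?_
    exact hH.comp (f := fun q : ℝ => (x, r, q)) (by fun_prop)
      fun q hq => ⟨mem_univ _, mem_univ _, hq.1⟩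
  constructor
  · intro h
    obtain ⟨q, hq, hqe⟩ := hcomp.sInf_mem ⟨_, p, ⟨hp, by simpa using ha⟩, rfl⟩
    exact ⟨q, hq.1, hq.2, hqe.trans_le h⟩
  · rintro ⟨q, hq, hqp, hle⟩
    exact (csInf_le hcomp.bddBelow ⟨q, ⟨hq, hqp⟩, rfl⟩).trans hle

/-- Stability of `Hlow H a x r p ≤ 0` under perturbation of all arguments. -/
theorem Hlow_nonpos_of_approx
    (hH : ContinuousOn (fun q : X × ℝ × ℝ => H q.1 q.2.1 q.2.2)
      ((univ : Set X) ×ˢ (univ : Set ℝ) ×ˢ Ici (0 : ℝ)))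
    {a p : ℝ} (ha : 0 ≤ a) (hp : 0 ≤ p) (x : X) (r : ℝ)
    (h : ∀ η > 0, ∃ z s q, dist z x ≤ η ∧ |s - r| ≤ η ∧ 0 ≤ q ∧ |q - p| ≤ a + η ∧ H z s q ≤ 0) :
    Hlow H a x r p ≤ 0 := by
  rw [Hlow_nonpos_iff hH ha hp]
  have hpos : ∀ n : ℕ, (0 : ℝ) < 1 / (n + 1) := fun n => Nat.one_div_pos_of_nat
  choose z s q hz hs hq hqp hle using fun n : ℕ => h (1 / (n + 1)) (hpos n)
  have hmem : ∀ n, q n ∈ Icc 0 (p + a + 1) := fun n => by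
    refine ⟨hq n, ?_⟩
    have h1 := (abs_le.1 (hqp n)).2
    have h2 : (1 : ℝ) / (n + 1) ≤ 1 := by
      rw [div_le_one (by positivity)]
      linarith [(n.cast_nonneg : (0 : ℝ) ≤ n)]
    linarith
  obtain ⟨q₀, hq₀, φ, hφ, hlim⟩ := isCompact_Icc.tendsto_subseq hmem
  have hη : Tendsto (fun n => (1 : ℝ) / ((φ n : ℝ) + 1)) atTop (𝓝 0) :=
    (tendsto_one_div_add_atTop_nhds_zero_nat (𝕜 := ℝ)).comp hφ.tendsto_atTop
  have hz' : Tendsto (z ∘ φ) atTop (𝓝 x) :=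
    tendsto_iff_dist_tendsto_zero.2
      (squeeze_zero (fun _ => dist_nonneg) (fun n => hz (φ n)) hη)
  have hs' : Tendsto (s ∘ φ) atTop (𝓝 r) :=
    tendsto_iff_dist_tendsto_zero.2
      (squeeze_zero (fun _ => dist_nonneg) (fun n => hs (φ n)) hη)
  refine ⟨q₀, hq₀.1, ?_, ?_⟩
  · have h1 := (hlim.sub_const p).abs
    have h2 := hη.const_add a
    rw [add_zero] at h2
    exact le_of_tendsto_of_tendsto' h1 h2 fun n => hqp (φ n)
  · have hcont := hH (x, r, q₀) ⟨mem_univ _, mem_univ _, hq₀.1⟩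
    have ht : Tendsto (fun n => ((z ∘ φ) n, (s ∘ φ) n, (q ∘ φ) n)) atTop
        (𝓝[(univ : Set X) ×ˢ (univ : Set ℝ) ×ˢ Ici (0 : ℝ)] (x, r, q₀)) :=
      tendsto_nhdsWithin_iff.2 ⟨hz'.prodMk_nhds (hs'.prodMk_nhds hlim),
        Eventually.of_forall fun n => ⟨mem_univ _, mem_univ _, hq (φ n)⟩⟩
    exact le_of_tendsto' (hcont.tendsto.comp ht) fun n => hle (φ n)

end Hamiltonian

section Perturbation

variable {X : Type*} [MetricSpace X]

/-- If `U` minus a test function has a local maximum at `x`, then arbitrarily close to `x` there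
is a local maximum of `U` minus a function of the form `k / 2 * dist a · ^ 2 + c * dist z ·`,
where the slopes are controlled by those of the test function. -/
theorem exists_isLocalMax_sq_dist_add_dist [CompleteSpace X]
    (hgeo : IsGeodesicWrt (univ : Set X) dist) {U : X → ℝ} (hU : UpperSemicontinuous U)
    {ψ₁ ψ₂ : X → ℝ} (hψ₁ : IsC1MinusWrt univ dist ψ₁) (hψ₂ : LocLipWrt univ dist ψ₂) {x : X}
    (hmax : IsLocalMax (fun y => U y - (ψ₁ y + ψ₂ y)) x) {η : ℝ} (hη : 0 < η) :
    ∃ a z k c, 0 ≤ k ∧ 0 ≤ c ∧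
      IsLocalMax (fun y => U y - (k / 2 * dist a y ^ 2 + c * dist z y)) z ∧
      dist z x ≤ η ∧ |U z - U x| ≤ η ∧
      |k * dist a z - slopeWrt univ dist ψ₁ x| + c ≤
        uscWrt univ (slopeWrt univ dist ψ₂) x + η := by
  obtain ⟨hlip₁, hcont₁, hlow₁⟩ := hψ₁
  have hp := slopeWrt_nonneg ψ₁ x
  have hL := uscWrt_slopeWrt_nonneg ψ₂ x
  have hlow := hlow₁ x (mem_univ x)
  set p := slopeWrt univ dist ψ₁ x
  set L := uscWrt univ (slopeWrt univ dist ψ₂) x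
  obtain ⟨ε, hε, hεη, hεp⟩ : ∃ ε > 0, 6 * ε ≤ η ∧ (0 < p → ε < p) := by
    rcases hp.eq_or_lt with h | h
    · exact ⟨η / 6, by positivity, by linarith, fun h' => absurd h' (h ▸ lt_irrefl _)⟩
    · exact ⟨min (η / 6) (p / 2), by positivity, by linarith [min_le_left (η / 6) (p / 2)],
        fun _ => by linarith [min_le_right (η / 6) (p / 2)]⟩
  have hev₁ : ∀ᶠ y in 𝓝 x, slopeWrt univ dist ψ₁ y < p + ε :=
    (continuousOn_univ.1 hcont₁).continuousAt.eventually_lt_const (by linarith)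
  have hev₂ : ∀ᶠ y in 𝓝 x, slopeWrt univ dist ψ₂ y < L + ε :=
    hψ₂.eventually_slopeWrt_lt (by linarith)
  obtain ⟨r, hr, hball⟩ := Metric.eventually_nhds_iff_ball.1
    ((hev₁.and hev₂).and (hmax.and (hU x (U x + η) (by linarith))))
  have hψ₂le : ∀ y, dist x y < r → ψ₂ y - ψ₂ x ≤ (L + ε) * dist x y := fun y hy =>
    hψ₂.sub_le_of_slopeWrt_le hgeo fun w hw =>
      (hball w (mem_ball'.2 (hw.trans_lt hy))).1.2.le
  rcases hp.eq_or_lt with hp0 | hp_pos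
  · refine ⟨x, x, 0, L + 2 * ε, le_rfl, by positivity, ?_, by simpa using hη.le,
      by simpa using hη.le, ?_⟩
    · filter_upwards [ball_mem_nhds x hr] with y hy
      have h1 := (hball y hy).2.1
      have hy' := mem_ball'.1 hy
      have h2 := hψ₂le y hy'
      have h3 := hlip₁.sub_le_of_slopeWrt_le hgeo (M := p + ε) fun w hw =>
        (hball w (mem_ball'.2 (hw.trans_lt hy'))).1.1.le
      rw [← hp0] at h3
      simp only [dist_self] at h1 ⊢
      linarith
    · rw [← hp0]
      simp only [zero_mul, sub_zero, abs_zero]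
      linarith
  replace hεp := hεp hp_pos
  obtain ⟨s, hs, hsr, hsη, hspη⟩ : ∃ s > 0, s ≤ r / 10 ∧ s ≤ η ∧ (p + ε) * s ≤ η := by
    have hpε : 0 < p + ε := by positivity
    refine ⟨min (r / 10) (min η (η / (p + ε))), by positivity, min_le_left _ _,
      (min_le_right _ _).trans (min_le_left _ _), ?_⟩
    rw [mul_comm, ← le_div_iff₀ hpε]
    exact (min_le_right _ _).trans (min_le_right _ _)
  obtain ⟨a, ha, hax, has⟩ := ((frequently_lt_of_lt_lowerSlopeWrt (m := p - ε) (by linarith)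
    (by rw [hlow]; linarith : p - ε < lowerSlopeWrt univ dist ψ₁ x)).and_eventually
    (eventually_mem_set.2 (inter_mem self_mem_nhdsWithin
      (mem_nhdsWithin_of_mem_nhds (ball_mem_nhds x hs))))).exists
  replace hax : 0 < dist x a := dist_pos.2 (Ne.symm hax)
  replace has : dist x a < s := mem_ball'.1 has
  have hUc : UpperSemicontinuous fun y => U y - ((p + ε) * dist a y + (L + ε) * dist x y) :=
    hU.sub_continuous (by fun_prop)
  have hbound : ∀ y, dist x y ≤ r / 4 →
      U y - ((p + ε) * dist a y + (L + ε) * dist x y) ≤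
        U x - (p + ε) * dist a x + 2 * ε * dist x a := by
    intro y hy
    have h1 := (hball y (mem_ball'.2 (by linarith))).2.1
    have h2 := hψ₂le y (by linarith)
    have h3 := hlip₁.sub_le_of_slopeWrt_le hgeo (x := a) (y := y) (M := p + ε) fun w hw => by
      refine (hball w (mem_ball'.2 ?_)).1.1.le
      have := dist_triangle x a w
      have := dist_triangle a x y
      rw [dist_comm a x] at this
      linarith
    simp only at h1
    rw [dist_comm a x]
    linarith
  obtain ⟨z, hzS, hxz, hz⟩ := hUc.exists_ekeland (isClosed_closedBall (x := x) (ε := r / 4))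
    (mem_closedBall_self (by positivity)) (δ := 4 * ε)
    (fun y hy => hbound y (mem_closedBall'.1 hy)) (by positivity)
  simp only [dist_self, mul_zero, add_zero] at hxz hz
  have hxz_le : dist x z ≤ dist x a / 2 := by
    have h1 := hbound z (mem_closedBall'.1 hzS)
    have : ε * dist x z ≤ ε * (dist x a / 2) := by linarith
    exact le_of_mul_le_mul_left this hε
  have haz : 0 < dist a z := by
    have := dist_triangle a z x
    rw [dist_comm a x, dist_comm z x] at this
    linarith
  have hkaz : (p + ε) / dist a z * dist a z = p + ε := div_mul_cancel₀ _ haz.ne'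
  have hyoung : ∀ t : ℝ, (p + ε) * t ≤
      (p + ε) / dist a z / 2 * t ^ 2 + (p + ε) * dist a z / 2 := by
    intro t
    have h1 : 0 ≤ (p + ε) / dist a z / 2 * (t - dist a z) ^ 2 := by positivity
    have h2 : (p + ε) / dist a z / 2 * t ^ 2 + (p + ε) * dist a z / 2 - (p + ε) * t =
        (p + ε) / dist a z / 2 * (t - dist a z) ^ 2 := by
      field_simp
      ring
    linarith
  refine ⟨a, z, (p + ε) / dist a z, L + 5 * ε, by positivity, by positivity, ?_, ?_, ?_, ?_⟩
  · filter_upwards [isOpen_ball.mem_nhds (mem_ball'.2 (by linarith : dist x z < r / 4))]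
      with y hy
    have h1 := hz y (ball_subset_closedBall hy)
    have h2 := hyoung (dist a y)
    have h3 : (L + ε) * dist x y ≤ (L + ε) * (dist x z + dist z y) := by
      gcongr
      exact dist_triangle x z y
    have h4 : (p + ε) / dist a z / 2 * dist a z ^ 2 = (p + ε) * dist a z / 2 := by
      field_simp
    rw [h4, dist_self]
    linarith
  · rw [dist_comm]
    linarith
  · have h1 := (hball z (mem_ball'.2 (by linarith))).2.2
    have h2 : (p + ε) * dist a x ≤ (p + ε) * (dist a z + dist x z) := by
      gcongr
      exact dist_triangle_right a x z
    have h3 : (p + ε) * dist x z ≤ (p + ε) * s := by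
      gcongr
      linarith
    have h4 : 0 ≤ (L + ε) * dist x z := by positivity
    have h5 : 0 ≤ 4 * ε * dist x z := by positivity
    exact abs_le.2 ⟨by linarith, by linarith⟩
  · rw [hkaz, add_sub_cancel_left, abs_of_pos hε]
    linarith

end Perturbation

/-- characterization of metric viscosity subsolutions on a (not
necessarily locally compact) complete geodesic space. -/
theorem stmt16 {X : Type*} [MetricSpace X] [CompleteSpace X]
    (hgeo : IsGeodesicWrt (univ : Set X) dist)
    (H : X → ℝ → ℝ → ℝ)
    (hH : ContinuousOn (fun q : X × ℝ × ℝ => H q.1 q.2.1 q.2.2)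
      ((univ : Set X) ×ˢ (univ : Set ℝ) ×ˢ Ici (0:ℝ)))
    (u : X → ℝ) (hu : LocBddWrt (univ : Set X) u) :
    (IsMVSubsolutionWrt (univ : Set X) dist H u ↔
      (∀ a b xhat : X, ∀ k c : ℝ, 0 ≤ k → 0 ≤ c →
        IsLocalMax
          (fun x => uscWrt (univ : Set X) u x - (k / 2 * dist a x ^ 2 + c * dist b x)) xhat →
        Hlow H c xhat (uscWrt (univ : Set X) u xhat) (k * dist a xhat) ≤ 0)) ∧
    ((∀ a b xhat : X, ∀ k c : ℝ, 0 ≤ k → 0 ≤ c →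
        IsLocalMax
          (fun x => uscWrt (univ : Set X) u x - (k / 2 * dist a x ^ 2 + c * dist b x)) xhat →
        Hlow H c xhat (uscWrt (univ : Set X) u xhat) (k * dist a xhat) ≤ 0) ↔
      (∀ a b xhat : X, ∀ k c : ℝ, 0 ≤ k → 0 ≤ c →
        IsStrictLocalMaxOn'
          (fun x => uscWrt (univ : Set X) u x - (k / 2 * dist a x ^ 2 + c * dist b x))
          univ xhat →
        Hlow H c xhat (uscWrt (univ : Set X) u xhat) (k * dist a xhat) ≤ 0)) := by

  refine ⟨⟨fun h a b x k c hk hc hmax => ?_, fun h ψ₁ ψ₂ hψ₁ hψ₂ x _ hmax => ?_⟩,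
    ⟨fun h a b x k c hk hc hmax => h a b x k c hk hc ?_,
      fun h a b x k c hk hc hmax => ?_⟩⟩
  · have h1 := h _ _ (isC1MinusWrt_half_sq_dist hgeo a hk) (locLipWrt_mul_dist b hc) x
      (mem_univ x) (hmax.on univ)
    rw [slopeWrt_half_sq_dist hgeo a x hk,
      Hlow_nonpos_iff hH (uscWrt_slopeWrt_nonneg _ x) (by positivity)] at h1
    rw [Hlow_nonpos_iff hH hc (by positivity)]
    obtain ⟨q, hq, hqp, hle⟩ := h1
    exact ⟨q, hq, hqp.trans (uscWrt_slopeWrt_mul_dist_le b x hc), hle⟩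
  · refine Hlow_nonpos_of_approx hH (uscWrt_slopeWrt_nonneg ψ₂ x) (slopeWrt_nonneg ψ₁ x) x _
      fun η hη => ?_
    obtain ⟨a, z, k, c, hk, hc, hz, hzx, hUz, hle⟩ := exists_isLocalMax_sq_dist_add_dist hgeo
      hu.upperSemicontinuous_uscWrt hψ₁ hψ₂ (isLocalMaxOn_univ_iff.1 hmax) hη
    obtain ⟨q, hq, hqp, hHq⟩ :=
      (Hlow_nonpos_iff hH hc (by positivity) z _).1 (h a z z k c hk hc hz)
    refine ⟨z, _, q, hzx, hUz, hq, ?_, hHq⟩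
    have := abs_sub_le q (k * dist a z) (slopeWrt univ dist ψ₁ x)
    linarith
  · rw [IsStrictLocalMaxOn', ← compl_eq_univ_sdiff, eventually_nhdsWithin_iff] at hmax
    filter_upwards [hmax] with y hy
    rcases eq_or_ne y x with rfl | hne
    · exact le_rfl
    · exact (hy hne).le
  · refine Hlow_nonpos_of_approx hH hc (by positivity) x _ fun η hη => ?_
    have hstrict : IsStrictLocalMaxOn' (fun y => uscWrt (univ : Set X) u y -
        (k / 2 * dist a y ^ 2 + (c + η) * dist x y)) univ x := by
      rw [IsStrictLocalMaxOn', ← compl_eq_univ_sdiff, eventually_nhdsWithin_iff]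
      filter_upwards [hmax] with y hy hne
      have h1 : 0 < η * dist x y := mul_pos hη (dist_pos.2 (Ne.symm hne))
      have h2 : c * dist b y ≤ c * (dist b x + dist x y) := by
        gcongr
        exact dist_triangle b x y
      rw [dist_self]
      linarith
    obtain ⟨q, hq, hqp, hHq⟩ := (Hlow_nonpos_iff hH (by positivity) (by positivity) x _).1
      (h a x x k (c + η) hk (by positivity) hstrict)
    exact ⟨x, _, q, by simpa using hη.le, by simpa using hη.le, hq, hqp, hHq⟩
end
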